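/- arXiv:2205.15457 — 7 statements merged into one kernel-verified Lean document; each statement's English description precedes it below -/
import Mathlib

section
/- For i = 1,2, let n_i ≥ 2 be integers, let G_i ⊆ SL(n_i,ℝ) be countable dense subgroups acting on ℝ^{n_i} (with Lebesgue measure λ_{n_i}) by matrix-vector multiplication, let δ : G₁ → G₂ be a group isomorphism, and let Δ : ℝ^{n₁} → ℝ^{n₂} be a nonsingular isomorphism such that for every g ∈ G₁, Δ(g·x) = δ(g)·Δ(x) for λ_{n₁}-a.e. x. Then n₁ = n₂ and, identifying ℝ^{n₂} with ℝ^{n₁}, there is a unique matrix A ∈ GL(n₁,ℝ) such that Δ(x) = A·x for a.e. x ∈ ℝ^{n₁} and δ(g) = A·g·A⁻¹ for all g ∈ G₁. -/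
open MeasureTheory

namespace DSL
open Matrix Filter Topology

abbrev SL (n : ℕ) := Matrix.SpecialLinearGroup (Fin n) ℝ
abbrev V (n : ℕ) := Fin n → ℝ

/-- The action. -/
def ac {n : ℕ} (g : SL n) (x : V n) : V n := (g : Matrix (Fin n) (Fin n) ℝ).mulVec x

lemma ac_mul {n : ℕ} (g h : SL n) (x : V n) : ac (g * h) x = ac g (ac h x) := by
  simp [ac, Matrix.mulVec_mulVec]

lemma ac_one {n : ℕ} (x : V n) : ac 1 x = x := by
  simp [ac]

lemma ac_zero {n : ℕ} (g : SL n) : ac g 0 = 0 := by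
  simp [ac]

lemma ac_add {n : ℕ} (g : SL n) (x y : V n) : ac g (x + y) = ac g x + ac g y := by
  simp [ac, Matrix.mulVec_add]

lemma ac_smul {n : ℕ} (g : SL n) (c : ℝ) (x : V n) : ac g (c • x) = c • ac g x := by
  simp [ac, Matrix.mulVec_smul]

lemma ac_inv {n : ℕ} (g : SL n) (x : V n) : ac g⁻¹ (ac g x) = x := by
  rw [← ac_mul, inv_mul_cancel, ac_one]

lemma ac_inv' {n : ℕ} (g : SL n) (x : V n) : ac g (ac g⁻¹ x) = x := by
  rw [← ac_mul, mul_inv_cancel, ac_one]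

lemma ac_ne {n : ℕ} (g : SL n) {x : V n} (hx : x ≠ 0) : ac g x ≠ 0 := by
  intro h
  apply hx
  rw [← ac_inv g x, h, ac_zero]

lemma ac_ext {n : ℕ} {g h : SL n} (H : ∀ x, ac g x = ac h x) : g = h := by
  apply Subtype.ext
  exact Matrix.ext_of_mulVec_single fun i => H _

lemma dual_eq {n : ℕ} (φ : V n →ₗ[ℝ] ℝ) (x : V n) :
    (fun i => φ (Pi.single i 1)) ⬝ᵥ x = φ x := by
  conv_rhs => rw [pi_eq_sum_univ' x]
  simp [dotProduct, mul_comm]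

lemma tv_mulVec {n : ℕ} (φ : V n →ₗ[ℝ] ℝ) (u x : V n) :
    (1 + vecMulVec u (fun i => φ (Pi.single i 1))).mulVec x = x + φ x • u := by
  rw [Matrix.add_mulVec, Matrix.one_mulVec, Matrix.vecMulVec_mulVec, dual_eq]
  ext i; simp

lemma tv_det {n : ℕ} (φ : V n →ₗ[ℝ] ℝ) (u : V n) :
    (1 + vecMulVec u (fun i => φ (Pi.single i 1)) : Matrix (Fin n) (Fin n) ℝ).det = 1 + φ u := by
  have h := Matrix.det_one_add_replicateCol_mul_replicateRow (ι := Unit) u (fun i => φ (Pi.single i 1))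
  rw [← Matrix.vecMulVec_eq, dual_eq] at h
  exact h

/-- A transvection. -/
def tv {n : ℕ} (φ : V n →ₗ[ℝ] ℝ) (u : V n) (h : φ u = 0) : SL n :=
  ⟨1 + vecMulVec u (fun i => φ (Pi.single i 1)), by rw [tv_det, h, add_zero]⟩

lemma ac_tv {n : ℕ} (φ : V n →ₗ[ℝ] ℝ) (u : V n) (h : φ u = 0) (x : V n) :
    ac (tv φ u h) x = x + φ x • u := tv_mulVec φ u x

lemma cont_tv {n : ℕ} (φ : V n →ₗ[ℝ] ℝ) (u : V n) (h : φ u = 0) :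
    Continuous fun t : ℝ => tv φ (t • u) (by simp [h]) := by
  refine Continuous.subtype_mk ?_ _
  refine continuous_const.add ?_
  refine continuous_matrix fun i j => ?_
  simp only [vecMulVec_apply]
  fun_prop

lemma det_of_ac {n : ℕ} (g : SL n) (φ : V n →ₗ[ℝ] ℝ) (u : V n)
    (H : ∀ x, ac g x = x + φ x • u) : φ u = 0 := by
  have : (g : Matrix (Fin n) (Fin n) ℝ) = 1 + vecMulVec u (fun i => φ (Pi.single i 1)) := by
    apply Matrix.ext_of_mulVec_single fun i => ?_
    rw [tv_mulVec]; exact H _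
  have h2 := tv_det φ u
  rw [← this, g.det_coe] at h2
  linarith

lemma exists_dual {n : ℕ} {L : Submodule ℝ (V n)} {v : V n} (hv : v ∉ L) :
    ∃ φ : V n →ₗ[ℝ] ℝ, φ v = 1 ∧ ∀ x ∈ L, φ x = 0 := by
  obtain ⟨f, hf, hL⟩ := Submodule.exists_le_ker_of_notMem hv
  refine ⟨(f v)⁻¹ • f, by simp [hf], fun x hx => ?_⟩
  have : f x = 0 := hL hx
  simp [this]

lemma exists_ker {n : ℕ} (hn : 2 ≤ n) (φ : V n →ₗ[ℝ] ℝ) : ∃ u, u ≠ 0 ∧ φ u = 0 := by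
  have h : φ.ker ≠ ⊥ := LinearMap.ker_ne_bot_of_finrank_lt (by simp; omega)
  obtain ⟨u, hu, h0⟩ := Submodule.exists_mem_ne_zero_of_ne_bot h
  exact ⟨u, h0, hu⟩

lemma exists_indep {n : ℕ} (hn : 2 ≤ n) (x y : V n) :
    ∃ z, z ∉ Submodule.span ℝ {x} ∧ z ∉ Submodule.span ℝ {y} := by
  have key : ∀ x : V n, Submodule.span ℝ {x} ≠ ⊤ := fun x h => by
    have h1 := finrank_span_le_card (R := ℝ) ({x} : Set (V n))
    rw [h, finrank_top] at h1
    simp at h1; omega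
  by_contra! hcon
  have h1 := Measure.addHaar_submodule (volume : Measure (V n)) _ (key x)
  have h2 := Measure.addHaar_submodule (volume : Measure (V n)) _ (key y)
  have h3 : (volume : Measure (V n)) (Submodule.span ℝ {x} ∪ Submodule.span ℝ {y} : Set (V n)) = 0 :=
    measure_union_null h1 h2
  have : (Submodule.span ℝ {x} ∪ Submodule.span ℝ {y} : Set (V n)) = Set.univ := by
    ext z
    by_cases hz : z ∈ Submodule.span ℝ {x}
    · simp [hz]
    · simp [hcon z hz]
  rw [this] at h3
  exact (isOpen_univ.measure_pos volume Set.univ_nonempty).ne' h3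

lemma trans_indep {n : ℕ} {x y : V n} (hx : x ≠ 0) (hy : y ∉ Submodule.span ℝ {x}) :
    ∃ g : SL n, ac g x = y := by
  have h : x ∉ Submodule.span ℝ {y - x} := by
    intro h
    obtain ⟨c, hc⟩ := Submodule.mem_span_singleton.1 h
    have hc0 : c ≠ 0 := by rintro rfl; simp at hc; exact hx hc.symm
    apply hy
    refine Submodule.mem_span_singleton.2 ⟨1 + c⁻¹, ?_⟩
    have : y - x = c⁻¹ • x := by rw [eq_inv_smul_iff₀ hc0, hc]
    rw [add_smul, one_smul, ← this]; abel
  obtain ⟨φ, h1, h2⟩ := exists_dual h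
  refine ⟨tv φ (y - x) (h2 _ (Submodule.mem_span_singleton_self _)), ?_⟩
  rw [ac_tv, h1]; simp

lemma notMem_symm {n : ℕ} {x y : V n} (hx : x ≠ 0) (hy : y ∉ Submodule.span ℝ {x}) :
    x ∉ Submodule.span ℝ {y} := by
  intro h
  obtain ⟨c, hc⟩ := Submodule.mem_span_singleton.1 h
  have hc0 : c ≠ 0 := by rintro rfl; simp at hc; exact hx hc.symm
  exact hy (Submodule.mem_span_singleton.2 ⟨c⁻¹, by rw [← hc, smul_smul, inv_mul_cancel₀ hc0, one_smul]⟩)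

lemma ne_zero_of_notMem {n : ℕ} {y : V n} {L : Submodule ℝ (V n)} (hy : y ∉ L) : y ≠ 0 := by
  rintro rfl; exact hy L.zero_mem

lemma trans {n : ℕ} (hn : 2 ≤ n) {x y : V n} (hx : x ≠ 0) (hy : y ≠ 0) :
    ∃ g : SL n, ac g x = y := by
  obtain ⟨z, h1, h2⟩ := exists_indep hn x y
  obtain ⟨g, hg⟩ := trans_indep hx h1
  obtain ⟨k, hk⟩ := trans_indep (ne_zero_of_notMem h1) (notMem_symm hy h2)
  exact ⟨k * g, by rw [ac_mul, hg, hk]⟩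

section Alg
variable {n m : ℕ}

lemma exists_sub (hn : 2 ≤ n) (F : V n ≃ V m) (D : SL n → SL m)
    (hF : ∀ g x, F (ac g x) = ac (D g) (F x)) (L : Submodule ℝ (V n)) :
    ∃ L' : Submodule ℝ (V m), ∀ x, F x ∈ L' ↔ x ∈ L := by
  refine ⟨{ carrier := {w | ∀ h : SL n, (∀ z ∈ L, ac h z = z) → ac (D h) w = w}
            add_mem' := ?_, zero_mem' := ?_, smul_mem' := ?_}, ?_⟩
  · intro a b ha hb h hh
    rw [ac_add, ha h hh, hb h hh]
  · intro h hh; exact ac_zero _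
  · intro c a ha h hh
    rw [ac_smul, ha h hh]
  · intro x
    constructor
    · intro hx
      by_contra hxL
      obtain ⟨φ, h1, h2⟩ := exists_dual hxL
      obtain ⟨u, hu0, hu⟩ := exists_ker hn φ
      have := hx (tv φ u hu) (fun z hz => by rw [ac_tv, h2 z hz]; simp)
      rw [← hF] at this
      have := F.injective this
      rw [ac_tv, h1] at this
      simp at this
      exact hu0 this
    · intro hx h hh
      rw [← hF, hh x hx]

lemma mem_span_of (hn : 2 ≤ n) (F : V n ≃ V m) (D : SL n → SL m)
    (hF : ∀ g x, F (ac g x) = ac (D g) (F x)) (S : Set (V n)) (x : V n)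
    (hx : F x ∈ Submodule.span ℝ (F '' S)) : x ∈ Submodule.span ℝ S := by
  obtain ⟨L', hL'⟩ := exists_sub hn F D hF (Submodule.span ℝ S)
  rw [← hL']
  refine (Submodule.span_le.2 ?_) hx
  rintro _ ⟨z, hz, rfl⟩
  exact (hL' z).2 (Submodule.subset_span hz)

lemma symm_equi (F : V n ≃ V m) (D : SL n ≃* SL m)
    (hF : ∀ g x, F (ac g x) = ac (D g) (F x)) (g : SL m) (x : V m) :
    F.symm (ac g x) = ac (D.symm g) (F.symm x) := by
  rw [Equiv.symm_apply_eq, hF]; simp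

lemma mem_span_iff (hn : 2 ≤ n) (hm : 2 ≤ m) (F : V n ≃ V m) (D : SL n ≃* SL m)
    (hF : ∀ g x, F (ac g x) = ac (D g) (F x)) (S : Set (V n)) (x : V n) :
    F x ∈ Submodule.span ℝ (F '' S) ↔ x ∈ Submodule.span ℝ S := by
  refine ⟨mem_span_of hn F D hF S x, fun h => ?_⟩
  refine mem_span_of hm F.symm D.symm (symm_equi F D hF) _ _ ?_
  simpa [Set.image_image] using h

lemma half_add (hn : 2 ≤ n) (hm : 2 ≤ m) (F : V n ≃ V m) (D : SL n ≃* SL m)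
    (hF : ∀ g x, F (ac g x) = ac (D g) (F x)) {x y : V n}
    (hy : y ∉ Submodule.span ℝ {x}) : ∃ a : ℝ, F (x + y) = F y + a • F x := by
  obtain ⟨φ, h1, h2⟩ := exists_dual hy
  have hφx : φ x = 0 := h2 x (Submodule.mem_span_singleton_self _)
  obtain ⟨H, hH⟩ := exists_sub hn F D hF φ.ker
  have hyH : F y ∉ H := by rw [hH]; simp [h1]
  obtain ⟨ψ, p1, p2⟩ := exists_dual hyH
  have hfix : ∀ w ∈ H, ac (D (tv φ x hφx)) w = w := by
    intro w hw
    obtain ⟨z, rfl⟩ := F.surjective w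
    have hz : φ z = 0 := (hH z).1 hw
    rw [← hF, ac_tv, hz]; simp
  have hyy : ac (D (tv φ x hφx)) (F y) = F (x + y) := by
    rw [← hF, ac_tv, h1, one_smul, add_comm]
  have hdec : ∀ w : V m, ∃ h ∈ H, w = h + ψ w • F y := by
    intro w
    obtain ⟨z, rfl⟩ := F.surjective w
    have hz : z ∈ Submodule.span ℝ (insert y (φ.ker : Set (V n))) := by
      rw [Submodule.mem_span_insert]
      refine ⟨φ z, z - φ z • y, Submodule.subset_span ?_, by abel⟩
      simp [h1]
    rw [← mem_span_iff hn hm F D hF, Set.image_insert_eq, Submodule.mem_span_insert] at hz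
    obtain ⟨c, w, hw, hcw⟩ := hz
    have hw' : w ∈ H := by
      refine (Submodule.span_le.2 ?_) hw
      rintro _ ⟨z, hz, rfl⟩
      exact (hH z).2 hz
    have : ψ (F z) = c := by rw [hcw]; simp [p1, p2 w hw']
    exact ⟨w, hw', by rw [this, hcw, add_comm]⟩
  have hu : ψ (F (x + y) - F y) = 0 := by
    refine det_of_ac (D (tv φ x hφx)) ψ _ fun w => ?_
    obtain ⟨h, hh, e⟩ := hdec w
    have : ac (D (tv φ x hφx)) w = h + ψ w • F (x + y) := by
      conv_lhs => rw [e]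
      rw [ac_add, ac_smul, hfix h hh, hyy]
    rw [this]
    conv_rhs => rw [e]
    simp only [map_add, map_smul, p1, p2 h hh, smul_sub]
    simp
  obtain ⟨h, hh, e⟩ := hdec (F (x + y) - F y)
  rw [hu, zero_smul, add_zero] at e
  obtain ⟨w, hw⟩ := F.surjective (F (x + y) - F y)
  have hwk : φ w = 0 := by
    have : F w ∈ H := by rw [hw, e]; exact hh
    exact (hH w).1 this
  have hws : w ∈ Submodule.span ℝ {x, y} := by
    rw [← mem_span_iff hn hm F D hF, hw]
    refine Submodule.sub_mem _ ?_ (Submodule.subset_span ⟨y, by simp, rfl⟩)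
    rw [mem_span_iff hn hm F D hF]
    exact Submodule.add_mem _ (Submodule.subset_span (by simp)) (Submodule.subset_span (by simp))
  obtain ⟨a, b, hab⟩ := Submodule.mem_span_pair.1 hws
  have hb : b = 0 := by
    rw [← hab] at hwk; simpa [hφx, h1] using hwk
  have hwx : w ∈ Submodule.span ℝ {x} := by
    rw [← hab, hb]; simp [Submodule.mem_span_singleton]
  rw [← mem_span_iff hn hm F D hF, Set.image_singleton, hw] at hwx
  obtain ⟨c, hc⟩ := Submodule.mem_span_singleton.1 hwx
  exact ⟨c, by rw [hc]; abel⟩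

lemma add_indep (hn : 2 ≤ n) (hm : 2 ≤ m) (F : V n ≃ V m) (D : SL n ≃* SL m)
    (hF : ∀ g x, F (ac g x) = ac (D g) (F x)) {x y : V n} (hx : x ≠ 0)
    (hy : y ∉ Submodule.span ℝ {x}) : F (x + y) = F x + F y := by
  obtain ⟨a, ha⟩ := half_add hn hm F D hF hy
  obtain ⟨b, hb⟩ := half_add hn hm F D hF (notMem_symm hx hy)
  rw [add_comm y x] at hb
  have hind : F y ∉ Submodule.span ℝ {F x} := by
    rw [← Set.image_singleton, mem_span_iff hn hm F D hF]; exact hy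
  have hb1 : b = 1 := by
    by_contra hb1
    apply hind
    have : (b - 1) • F y = (a - 1) • F x := by
      have := ha.symm.trans hb
      rw [sub_smul, sub_smul, one_smul, one_smul]
      rw [sub_eq_sub_iff_add_eq_add, add_comm, ← this, add_comm]
    refine Submodule.mem_span_singleton.2 ⟨(b - 1)⁻¹ * (a - 1), ?_⟩
    rw [mul_smul, ← this, smul_smul, inv_mul_cancel₀ (sub_ne_zero.2 hb1), one_smul]
  rw [hb, hb1, one_smul]

lemma F_add (hn : 2 ≤ n) (hm : 2 ≤ m) (F : V n ≃ V m) (D : SL n ≃* SL m) (h0 : F 0 = 0)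
    (hF : ∀ g x, F (ac g x) = ac (D g) (F x)) (x y : V n) : F (x + y) = F x + F y := by
  by_cases hx : x = 0
  · simp [hx, h0]
  by_cases hy : y ∈ Submodule.span ℝ {x}
  swap
  · exact add_indep hn hm F D hF hx hy
  obtain ⟨c, rfl⟩ := Submodule.mem_span_singleton.1 hy
  obtain ⟨z, hz, -⟩ := exists_indep hn x x
  by_cases hc : c = 0
  · simp [hc, h0]
  have hcx : c • x ≠ 0 := smul_ne_zero hc hx
  have e1 : F (c • x + (x + z)) = F (c • x) + F (x + z) := by
    refine add_indep hn hm F D hF hcx fun h => hz ?_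
    rw [Submodule.span_singleton_smul_eq (IsUnit.mk0 c hc)] at h
    simpa using Submodule.sub_mem _ h (Submodule.mem_span_singleton_self x)
  have e2 : F (x + z) = F x + F z := add_indep hn hm F D hF hx hz
  have e3 : F ((x + c • x) + z) = F (x + c • x) + F z := by
    by_cases h : x + c • x = 0
    · simp [h, h0]
    · refine add_indep hn hm F D hF h fun h => hz ?_
      refine (Submodule.span_le.2 ?_) h
      simp only [Set.singleton_subset_iff, SetLike.mem_coe]
      exact Submodule.add_mem _ (Submodule.mem_span_singleton_self x) hy
  have : c • x + (x + z) = (x + c • x) + z := by abel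
  rw [this, e3, e2] at e1
  have h := add_right_cancel (e1.trans (add_assoc _ _ _).symm)
  rw [h, add_comm]

lemma F_lin (hn : 2 ≤ n) (hm : 2 ≤ m) (F : V n ≃ V m) (D : SL n ≃* SL m) (hD : Continuous D)
    (h0 : F 0 = 0) (hF : ∀ g x, F (ac g x) = ac (D g) (F x)) (c : ℝ) (x : V n) :
    F (c • x) = c • F x := by
  by_cases hx : x = 0
  · simp [hx, h0]
  obtain ⟨y, hy, -⟩ := exists_indep hn x x
  obtain ⟨φ, h1, h2⟩ := exists_dual hy
  have hφx : φ x = 0 := h2 x (Submodule.mem_span_singleton_self _)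
  have hadd := F_add hn hm F D h0 hF
  let f : ℝ →+ V m := { toFun := fun t => F (t • x), map_zero' := by simp [h0],
                        map_add' := fun s t => by rw [add_smul, hadd] }
  have hf : Continuous f := by
    have : ∀ t, f t = ac (D (tv φ (t • x) (by simp [hφx]))) (F y) - F y := by
      intro t
      rw [← hF, ac_tv, h1, one_smul, hadd]
      simp [f]
    rw [show (f : ℝ → V m) = _ from funext this]
    have h3 : Continuous fun t : ℝ => (D (tv φ (t • x) (by simp [hφx]))) := hD.comp (cont_tv φ x hφx)
    have h4 := continuous_subtype_val.comp h3
    exact (h4.matrix_mulVec continuous_const).sub continuous_const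
  have := map_real_smul f hf c 1
  simpa [f] using this

lemma F_mat (hn : 2 ≤ n) (hm : 2 ≤ m) (F : V n ≃ V m) (D : SL n ≃* SL m) (hD : Continuous D)
    (h0 : F 0 = 0) (hF : ∀ g x, F (ac g x) = ac (D g) (F x)) :
    n = m ∧ ∃ A : Matrix (Fin m) (Fin n) ℝ, (∃ B : Matrix (Fin n) (Fin m) ℝ, A * B = 1 ∧ B * A = 1) ∧
      ∀ x, F x = A.mulVec x := by
  let e : V n ≃ₗ[ℝ] V m := { F with map_add' := F_add hn hm F D h0 hF,
                                    map_smul' := F_lin hn hm F D hD h0 hF }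
  refine ⟨by simpa using e.finrank_eq, LinearMap.toMatrix' e.toLinearMap,
    ⟨LinearMap.toMatrix' e.symm.toLinearMap, ?_, ?_⟩, ?_⟩
  · rw [← LinearMap.toMatrix'_comp]; simp
  · rw [← LinearMap.toMatrix'_comp]; simp
  · intro x
    rw [LinearMap.toMatrix'_mulVec]; rfl

end Alg

lemma cont_ac {n : ℕ} : Continuous fun p : SL n × V n => ac p.1 p.2 :=
  (continuous_subtype_val.comp continuous_fst).matrix_mulVec continuous_snd

lemma cont_ac' {n : ℕ} (g : SL n) : Continuous (ac g) :=
  cont_ac.comp (continuous_const.prodMk continuous_id)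

lemma mp {n : ℕ} (g : SL n) : MeasurePreserving (ac g) volume volume := by
  refine ⟨(cont_ac' g).measurable, ?_⟩
  have h := Real.map_matrix_volume_pi_eq_smul_volume_pi
    (M := (g : Matrix (Fin n) (Fin n) ℝ)) (by rw [g.2]; exact one_ne_zero)
  rw [g.2] at h
  simp only [inv_one, abs_one, ENNReal.ofReal_one, one_smul] at h
  exact h

/-- Integrable weight. -/
noncomputable def wt {n : ℕ} (x : V n) : ℝ := ∏ i, Real.exp (-1 * x i ^ 2)

lemma wt_pos {n : ℕ} (x : V n) : 0 < wt x := Finset.prod_pos fun _ _ => Real.exp_pos _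

lemma wt_cont {n : ℕ} : Continuous (wt (n := n)) := by
  unfold wt; fun_prop

lemma wt_int {n : ℕ} : Integrable (wt (n := n)) volume := by
  unfold wt
  exact Integrable.fintype_prod (f := fun _ t => Real.exp (-1 * t ^ 2))
    fun _ => integrable_exp_neg_mul_sq one_pos

lemma subseq {n m : ℕ} {Δ : V n → V m} (hΔ : Measurable Δ) (g : ℕ → SL n) (g0 : SL n)
    (hg : Tendsto g atTop (𝓝 g0)) : ∃ ns : ℕ → ℕ, StrictMono ns ∧
      ∀ᵐ x, Tendsto (fun k => Δ (ac (g (ns k)) x)) atTop (𝓝 (Δ (ac g0 x))) := by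
  let f : V n → V m := fun x => wt x • (fun i => Real.arctan (Δ x i))
  have hfm : Measurable f := by
    refine measurable_pi_lambda _ fun i => ?_
    exact wt_cont.measurable.mul (Real.measurable_arctan.comp ((measurable_pi_apply i).comp hΔ))
  have hfi : Integrable f volume := by
    refine Integrable.mono' (wt_int.mul_const 2) hfm.aestronglyMeasurable (ae_of_all _ fun x => ?_)
    rw [norm_smul, Real.norm_of_nonneg (wt_pos x).le]
    refine mul_le_mul_of_nonneg_left ?_ (wt_pos x).le
    refine (pi_norm_le_iff_of_nonneg (by norm_num)).2 fun i => ?_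
    have h1 := Real.arctan_lt_pi_div_two (Δ x i)
    have h2 := Real.neg_pi_div_two_lt_arctan (Δ x i)
    have h3 := Real.pi_le_four
    rw [Real.norm_eq_abs, abs_le]
    constructor <;> linarith
  have hL : MemLp f 1 (volume : Measure (V n)) := memLp_one_iff_integrable.2 hfi
  let Φ : C(SL n × V n, V n) := ⟨fun p => ac p.1 p.2, cont_ac⟩
  have hΦ : Tendsto (fun k => Φ.curry (g k)) atTop (𝓝 (Φ.curry g0)) :=
    (Φ.curry.continuous.tendsto g0).comp hg
  have hT := Filter.Tendsto.compMeasurePreservingLp (μ := volume) (ν := volume)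
    (f := fun _ : ℕ => hL.toLp f) tendsto_const_nhds hΦ (fun k => mp (g k)) (mp g0) (by simp)
  obtain ⟨ns, hns, h⟩ := (tendstoInMeasure_of_tendsto_Lp hT).exists_seq_tendsto_ae
  refine ⟨ns, hns, ?_⟩
  have hc : ∀ k : SL n, (Lp.compMeasurePreserving (Φ.curry k) (mp k) (hL.toLp f)) =ᵐ[volume]
      f ∘ ac k := by
    intro k
    refine (Lp.coeFn_compMeasurePreserving _ _).trans ?_
    exact (mp k).quasiMeasurePreserving.ae_eq_comp hL.coeFn_toLp
  have hall : ∀ᵐ x, ∀ k : ℕ, (Lp.compMeasurePreserving (Φ.curry (g k)) (mp (g k)) (hL.toLp f)) x =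
      f (ac (g k) x) := ae_all_iff.2 fun k => hc (g k)
  filter_upwards [h, hall, hc g0] with x h1 h2 h3
  rw [h3] at h1
  have h4 : Tendsto (fun k => f (ac (g (ns k)) x)) atTop (𝓝 (f (ac g0 x))) := by
    refine h1.congr fun k => ?_
    exact h2 (ns k)
  have hgn : Tendsto (fun k => g (ns k)) atTop (𝓝 g0) := hg.comp hns.tendsto_atTop
  have hw : Tendsto (fun k => wt (ac (g (ns k)) x)) atTop (𝓝 (wt (ac g0 x))) := by
    have : Continuous fun k : SL n => wt (ac k x) :=
      wt_cont.comp (cont_ac.comp (continuous_id.prodMk continuous_const))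
    exact (this.tendsto g0).comp hgn
  rw [tendsto_pi_nhds] at h4 ⊢
  intro i
  have h5 := (hw.inv₀ (wt_pos _).ne').mul (h4 i)
  have e : ∀ y, (wt y)⁻¹ * f y i = Real.arctan (Δ y i) := fun y => by
    simp only [f, Pi.smul_apply, smul_eq_mul]
    rw [inv_mul_cancel_left₀ (wt_pos y).ne']
  simp only [e] at h5
  have h6 := ((Real.continuousAt_tan.2 (Real.cos_arctan_pos (Δ (ac g0 x) i)).ne').tendsto).comp h5
  simpa [Function.comp_def, Real.tan_arctan] using h6

section Ext
variable {n m : ℕ} {Δ : V n → V m}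

instance neb : (ae (volume : Measure (V n))).NeBot := inferInstance

lemma span_top (q : Measure.QuasiMeasurePreserving Δ volume volume) {P : V n → Prop}
    (hP : ∀ᵐ x, P x) : Submodule.span ℝ (Δ '' {x | P x}) = ⊤ := by
  by_contra hne
  have h0 := Measure.addHaar_submodule (volume : Measure (V m)) _ hne
  have h1 := q.preimage_null h0
  have h2 : ∀ᵐ x, Δ x ∉ Submodule.span ℝ (Δ '' {x | P x}) := by
    rw [ae_iff]; simp only [not_not]; exact h1
  obtain ⟨x, hx, hx'⟩ := (hP.and h2).exists
  exact hx' (Submodule.subset_span ⟨x, hx, rfl⟩)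

lemma conv_all {S : Set (V m)} (hS : Submodule.span ℝ S = ⊤)
    (h : ℕ → Matrix (Fin m) (Fin m) ℝ)
    (hc : ∀ v ∈ S, ∃ w, Tendsto (fun k => (h k).mulVec v) atTop (𝓝 w)) (v : V m) :
    ∃ w, Tendsto (fun k => (h k).mulVec v) atTop (𝓝 w) := by
  have hv : v ∈ Submodule.span ℝ S := hS ▸ Submodule.mem_top
  induction hv using Submodule.span_induction with
  | mem x hx => exact hc x hx
  | zero => exact ⟨0, by simp⟩
  | add x y _ _ hx hy =>
    obtain ⟨a, ha⟩ := hx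
    obtain ⟨b, hb⟩ := hy
    exact ⟨a + b, by simpa [Matrix.mulVec_add] using ha.add hb⟩
  | smul c x _ hx =>
    obtain ⟨a, ha⟩ := hx
    exact ⟨c • a, by simpa [Matrix.mulVec_smul] using ha.const_smul c⟩

lemma conv_mat {S : Set (V m)} (hS : Submodule.span ℝ S = ⊤)
    (h : ℕ → Matrix (Fin m) (Fin m) ℝ)
    (hc : ∀ v ∈ S, ∃ w, Tendsto (fun k => (h k).mulVec v) atTop (𝓝 w)) :
    ∃ H, Tendsto h atTop (𝓝 H) := by
  choose w hw using conv_all hS h hc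
  refine ⟨fun i j => w (Pi.single j 1) i, ?_⟩
  refine tendsto_pi_nhds.2 fun i => tendsto_pi_nhds.2 fun j => ?_
  have := tendsto_pi_nhds.1 (hw (Pi.single j 1)) i
  simpa using this

lemma uniq (q : Measure.QuasiMeasurePreserving Δ volume volume) {h k : Matrix (Fin m) (Fin m) ℝ}
    (H : ∀ᵐ x, h.mulVec (Δ x) = k.mulVec (Δ x)) : h = k := by
  have hs := span_top q H
  have : Matrix.toLin' h = Matrix.toLin' k := by
    refine LinearMap.ext_on hs ?_
    rintro _ ⟨x, hx, rfl⟩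
    exact hx
  exact Matrix.toLin'.injective this

/-- The relation extending the isomorphism. -/
def R (Δ : V n → V m) (g : SL n) (h : SL m) : Prop := ∀ᵐ x, Δ (ac g x) = ac h (Δ x)

lemma R_uniq (q : Measure.QuasiMeasurePreserving Δ volume volume) {g : SL n} {h k : SL m}
    (h1 : R Δ g h) (h2 : R Δ g k) : h = k := by
  apply Subtype.ext
  refine uniq q ?_
  filter_upwards [h1, h2] with x a b
  exact a.symm.trans b

lemma R_mul {g g' : SL n} {h h' : SL m} (h1 : R Δ g h) (h2 : R Δ g' h') :
    R Δ (g * g') (h * h') := by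
  filter_upwards [h2, (mp g').quasiMeasurePreserving.ae h1] with x a b
  rw [ac_mul, ac_mul, b, a]

/-- Limits of related pairs: subsequence convergence. -/
lemma R_lim (q : Measure.QuasiMeasurePreserving Δ volume volume) {g : ℕ → SL n} {h : ℕ → SL m}
    {g0 : SL n} (hR : ∀ k, R Δ (g k) (h k)) (hg : Tendsto g atTop (𝓝 g0)) :
    ∃ ns : ℕ → ℕ, StrictMono ns ∧ ∃ h0, Tendsto (fun k => h (ns k)) atTop (𝓝 h0) ∧ R Δ g0 h0 := by
  obtain ⟨ns, hns, hx⟩ := subseq q.measurable g g0 hg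
  have hx' : ∀ᵐ x, Tendsto (fun k => ((h (ns k)) : Matrix (Fin m) (Fin m) ℝ).mulVec (Δ x)) atTop
      (𝓝 (Δ (ac g0 x))) := by
    filter_upwards [hx, ae_all_iff.2 hR] with x h1 h2
    exact h1.congr fun k => h2 (ns k)
  obtain ⟨H, hH⟩ := conv_mat (span_top q hx')
    (fun k => ((h (ns k)) : Matrix (Fin m) (Fin m) ℝ)) (by
      rintro _ ⟨x, hx, rfl⟩
      exact ⟨_, hx⟩)
  have hdet : H.det = 1 := by
    have h1 : Tendsto (fun k => ((h (ns k)) : Matrix (Fin m) (Fin m) ℝ).det) atTop (𝓝 H.det) :=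
      ((Continuous.matrix_det continuous_id).tendsto H).comp hH
    refine tendsto_nhds_unique h1 (tendsto_const_nhds.congr fun k => ?_)
    exact (h (ns k)).2.symm
  refine ⟨ns, hns, ⟨H, hdet⟩, ?_, ?_⟩
  · exact tendsto_subtype_rng.2 hH
  · filter_upwards [hx'] with x h1
    refine tendsto_nhds_unique h1 ?_
    have : Continuous fun M : Matrix (Fin m) (Fin m) ℝ => M.mulVec (Δ x) :=
      continuous_id.matrix_mulVec continuous_const
    exact (this.tendsto H).comp hH

lemma R_exists (q : Measure.QuasiMeasurePreserving Δ volume volume) (G : Subgroup (SL n))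
    (hd : ∀ M : SL n, (M : Matrix (Fin n) (Fin n) ℝ) ∈
        closure {x : Matrix (Fin n) (Fin n) ℝ | ∃ g ∈ G, (g : Matrix (Fin n) (Fin n) ℝ) = x})
    (hR : ∀ g ∈ G, ∃ h, R Δ g h) (g : SL n) : ∃ h, R Δ g h := by
  haveI : FirstCountableTopology (Matrix (Fin n) (Fin n) ℝ) :=
    inferInstanceAs (FirstCountableTopology (Fin n → Fin n → ℝ))
  obtain ⟨u, hu, hlim⟩ := mem_closure_iff_seq_limit.1 (hd g)
  choose k hk hku using hu
  choose h hh using fun i => hR (k i) (hk i)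
  have hkt : Tendsto k atTop (𝓝 g) := by
    refine tendsto_subtype_rng.2 ?_
    refine hlim.congr fun i => (hku i).symm
  obtain ⟨-, -, h0, -, hR0⟩ := R_lim q hh hkt
  exact ⟨h0, hR0⟩

instance fc : FirstCountableTopology (SL n) := by
  haveI : FirstCountableTopology (Matrix (Fin n) (Fin n) ℝ) :=
    inferInstanceAs (FirstCountableTopology (Fin n → Fin n → ℝ))
  exact Topology.IsInducing.subtypeVal.firstCountableTopology

instance sc : SecondCountableTopology (SL n) := by
  haveI : SecondCountableTopology (Matrix (Fin n) (Fin n) ℝ) :=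
    inferInstanceAs (SecondCountableTopology (Fin n → Fin n → ℝ))
  exact Topology.IsInducing.subtypeVal.secondCountableTopology

instance lc : LocallyCompactSpace (SL n) := by
  haveI : LocallyCompactSpace (Matrix (Fin n) (Fin n) ℝ) :=
    inferInstanceAs (LocallyCompactSpace (Fin n → Fin n → ℝ))
  have hc : IsClosed {M : Matrix (Fin n) (Fin n) ℝ | M.det = 1} :=
    isClosed_eq (Continuous.matrix_det continuous_id) continuous_const
  exact hc.isClosedEmbedding_subtypeVal.locallyCompactSpace

lemma D_cont (q : Measure.QuasiMeasurePreserving Δ volume volume) (D : SL n → SL m)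
    (hD : ∀ g, R Δ g (D g)) : Continuous D := by
  rw [continuous_iff_seqContinuous]
  intro g g0 hg
  refine tendsto_of_subseq_tendsto fun ns hns => ?_
  obtain ⟨ms, hms, h0, hl, hR⟩ := R_lim q (fun k => hD (g (ns k))) (hg.comp hns)
  refine ⟨ms, ?_⟩
  rw [R_uniq q (hD g0) hR]
  exact hl

lemma strict (hn : 2 ≤ n) (hm : Measurable Δ) (D : SL n →* SL m) (hDc : Continuous D)
    (hD : ∀ g, R Δ g (D g)) :
    ∃ f : V n → V m, (∀ g x, x ≠ 0 → f (ac g x) = ac (D g) (f x)) ∧ f =ᵐ[volume] Δ := by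
  letI : MeasurableSpace (SL n) := borel _
  haveI : BorelSpace (SL n) := ⟨rfl⟩
  letI : MeasurableSpace (SL m) := borel _
  haveI : BorelSpace (SL m) := ⟨rfl⟩
  let μ : Measure (SL n) := Measure.haar
  let P : V n → V m → Prop := fun x c => ∀ᵐ g ∂μ, ac (D g) (Δ (ac g⁻¹ x)) = c
  have huniq : ∀ x c c', P x c → P x c' → c = c' := by
    intro x c c' h h'
    obtain ⟨g, h1, h2⟩ := (h.and h').exists
    exact h1.symm.trans h2
  have hae : ∀ᵐ x, P x (Δ x) := by
    have h1 : ∀ᵐ g ∂μ, ∀ᵐ x, ac (D g) (Δ (ac g⁻¹ x)) = Δ x := by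
      refine ae_of_all _ fun g => ?_
      filter_upwards [(mp g⁻¹).quasiMeasurePreserving.ae (hD g)] with x hx
      rw [← hx, ac_inv']
    refine (Measure.ae_ae_comm ?_).1 h1
    refine measurableSet_eq_fun ?_ (hm.comp measurable_snd)
    have a1 : Measurable fun p : SL n × V n => ac p.1⁻¹ p.2 :=
      (cont_ac.comp (continuous_fst.inv.prodMk continuous_snd)).measurable
    have a2 : Measurable fun p : SL n × V n => (D p.1, Δ (ac p.1⁻¹ p.2)) :=
      (hDc.measurable.comp measurable_fst).prodMk (hm.comp a1)
    exact cont_ac.measurable.comp a2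
  have htr : ∀ k x c, P x c → P (ac k x) (ac (D k) c) := by
    intro k x c h
    refine (eventually_mul_left_iff μ k).1 ?_
    filter_upwards [h] with g hg
    rw [map_mul, ac_mul, _root_.mul_inv_rev, ac_mul, ac_inv, hg]
  have hne : ∀ᵐ x : V n, x ≠ 0 := by
    haveI : Nonempty (Fin n) := ⟨⟨0, by omega⟩⟩
    exact Measure.ae_ne volume 0
  obtain ⟨x0, hx0, hx0'⟩ := (hae.and hne).exists
  have hex : ∀ x, ∃ c, x ≠ 0 → P x c := by
    intro x
    by_cases hx : x = 0
    · exact ⟨0, fun h => (h hx).elim⟩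
    · obtain ⟨g, rfl⟩ := trans hn hx0' hx
      exact ⟨_, fun _ => htr g _ _ hx0⟩
  choose f hf using hex
  refine ⟨f, fun g x hx => ?_, ?_⟩
  · exact huniq _ _ _ (hf _ (ac_ne g hx)) (htr g _ _ (hf x hx))
  · filter_upwards [hae, hne] with x h1 h2
    exact huniq _ _ _ (hf x h2) h1

end Ext

/-- Mutually inverse nonsingular maps. -/
structure Cj {n m : ℕ} (Δ : V n → V m) (E : V m → V n) : Prop where
  q1 : Measure.QuasiMeasurePreserving Δ volume volume
  q2 : Measure.QuasiMeasurePreserving E volume volume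
  i1 : ∀ᵐ x, E (Δ x) = x
  i2 : ∀ᵐ y, Δ (E y) = y

section Fin
variable {n m : ℕ} {Δ : V n → V m} {E : V m → V n}

lemma Cj.symm (c : Cj Δ E) : Cj E Δ := ⟨c.q2, c.q1, c.i2, c.i1⟩

lemma Cj.R_symm (c : Cj Δ E) {g : SL n} {h : SL m} (hR : R Δ g h) : R E h g := by
  have h1 : ∀ᵐ x, E (Δ (ac g x)) = ac g x := (mp g).quasiMeasurePreserving.ae c.i1
  filter_upwards [c.q2.ae hR, c.q2.ae h1, c.i2] with y a b d
  rw [← b, a, d]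

lemma ne0 {n : ℕ} (hn : 2 ≤ n) : ∀ᵐ x : V n, x ≠ 0 := by
  haveI : Nonempty (Fin n) := ⟨⟨0, by omega⟩⟩
  exact Measure.ae_ne volume 0

lemma Cj.inv (c : Cj Δ E) (hn : 2 ≤ n) (hm : 2 ≤ m) (D : SL n ≃* SL m) {f : V n → V m}
    {e : V m → V n}
    (hf : ∀ g x, x ≠ 0 → f (ac g x) = ac (D g) (f x)) (hfΔ : f =ᵐ[volume] Δ)
    (he : ∀ g x, x ≠ 0 → e (ac g x) = ac (D.symm g) (e x)) (heE : e =ᵐ[volume] E) :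
    ∀ x, x ≠ 0 → f x ≠ 0 ∧ e (f x) = x := by
  obtain ⟨x0, h0, h1, h2, h3, h4⟩ := ((ne0 hn).and (hfΔ.and (c.i1.and
    ((c.q1.ae (ne0 hm)).and (c.q1.ae heE))))).exists
  have h5 : f x0 ≠ 0 := by rw [h1]; exact h3
  intro x hx
  obtain ⟨g, rfl⟩ := trans hn h0 hx
  rw [hf g x0 h0]
  refine ⟨ac_ne _ h5, ?_⟩
  rw [he _ _ h5, MulEquiv.symm_apply_apply, h1, h4, h2]

lemma Cj.main (c : Cj Δ E) (hn : 2 ≤ n) (hm : 2 ≤ m)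
    (h1 : ∀ g, ∃ h, R Δ g h) (h2 : ∀ h, ∃ g, R E h g) :
    n = m ∧ ∃ A : Matrix (Fin m) (Fin n) ℝ,
      (∃ B : Matrix (Fin n) (Fin m) ℝ, A * B = 1 ∧ B * A = 1) ∧
      (∀ᵐ x, Δ x = A.mulVec x) ∧
      ∀ g h, R Δ g h → (h : Matrix (Fin m) (Fin m) ℝ) * A = A * (g : Matrix (Fin n) (Fin n) ℝ) := by
  choose d hd using h1
  choose d' hd' using h2
  let D : SL n ≃* SL m :=
    { toFun := d
      invFun := d'
      left_inv := fun g => R_uniq c.q2 (hd' _) (c.R_symm (hd g))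
      right_inv := fun g => R_uniq c.q1 (hd _) (c.symm.R_symm (hd' g))
      map_mul' := fun g h => R_uniq c.q1 (hd _) (R_mul (hd g) (hd h)) }
  have hDc : Continuous D := D_cont c.q1 d hd
  have hDc' : Continuous D.symm := D_cont c.q2 d' hd'
  obtain ⟨f, hf, hfΔ⟩ := strict hn c.q1.measurable D.toMonoidHom hDc hd
  obtain ⟨e, he, heE⟩ := strict hm c.q2.measurable D.symm.toMonoidHom hDc' hd'
  have k1 := c.inv hn hm D hf hfΔ he heE
  have k2 := c.symm.inv hm hn D.symm he heE hf hfΔ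
  classical
  let F : V n ≃ V m :=
    { toFun := fun x => if x = 0 then 0 else f x
      invFun := fun x => if x = 0 then 0 else e x
      left_inv := fun x => by
        by_cases hx : x = 0
        · simp [hx]
        · simp [hx, (k1 x hx).1, (k1 x hx).2]
      right_inv := fun x => by
        by_cases hx : x = 0
        · simp [hx]
        · simp [hx, (k2 x hx).1, (k2 x hx).2] }
  have hF0 : F 0 = 0 := by simp [F]
  have hF1 : ∀ x, x ≠ 0 → F x = f x := fun x hx => by simp [F, hx]
  have hF : ∀ g x, F (ac g x) = ac (D g) (F x) := by
    intro g x
    by_cases hx : x = 0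
    · rw [hx, ac_zero, hF0, ac_zero]
    · rw [hF1 _ hx, hF1 _ (ac_ne g hx)]; exact hf g x hx
  obtain ⟨hnm, A, hB, hA⟩ := F_mat hn hm F D hDc hF0 hF
  refine ⟨hnm, A, hB, ?_, ?_⟩
  · filter_upwards [hfΔ, ne0 hn] with x a b
    rw [← a, ← hA, hF1 x b]
  · intro g h hR
    have : h = D g := R_uniq c.q1 hR (hd g)
    subst this
    refine Matrix.ext_of_mulVec_single fun i => ?_
    have := hF g (Pi.single i 1)
    rw [hA, hA] at this
    rw [← Matrix.mulVec_mulVec, ← Matrix.mulVec_mulVec]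
    exact this.symm

end Fin

end DSL

/-- If `G₁ ⊆ SL(n₁,ℝ)` and `G₂ ⊆ SL(n₂,ℝ)` are countable dense subgroups,
`δ : G₁ → G₂` is a group isomorphism and `Δ : ℝ^{n₁} → ℝ^{n₂}` is a nonsingular isomorphism
with `Δ(g·x) = δ(g)·Δ(x)` a.e. for every `g ∈ G₁`, then `n₁ = n₂` and there is a unique
invertible matrix `A` with `Δ(x) = A x` a.e. and `δ(g) = A g A⁻¹` for all `g ∈ G₁` (the
conjugation identity being expressed as `δ(g) · A = A · g`). -/
theorem conjugacy_of_dense_subgroups_is_linear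
    (n₁ n₂ : ℕ) (hn₁ : 2 ≤ n₁) (hn₂ : 2 ≤ n₂)
    (G₁ : Subgroup (Matrix.SpecialLinearGroup (Fin n₁) ℝ))
    (G₂ : Subgroup (Matrix.SpecialLinearGroup (Fin n₂) ℝ))
    (hc₁ : Countable G₁) (hc₂ : Countable G₂)
    (hd₁ : ∀ M : Matrix.SpecialLinearGroup (Fin n₁) ℝ,
      (M : Matrix (Fin n₁) (Fin n₁) ℝ) ∈
        closure {x : Matrix (Fin n₁) (Fin n₁) ℝ |
          ∃ g ∈ G₁, (g : Matrix (Fin n₁) (Fin n₁) ℝ) = x})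
    (hd₂ : ∀ M : Matrix.SpecialLinearGroup (Fin n₂) ℝ,
      (M : Matrix (Fin n₂) (Fin n₂) ℝ) ∈
        closure {x : Matrix (Fin n₂) (Fin n₂) ℝ |
          ∃ g ∈ G₂, (g : Matrix (Fin n₂) (Fin n₂) ℝ) = x})
    (δ : G₁ ≃* G₂)
    (Δ : (Fin n₁ → ℝ) → (Fin n₂ → ℝ)) (hΔmeas : Measurable Δ)
    (hΔinv : ∃ Δ' : (Fin n₂ → ℝ) → (Fin n₁ → ℝ), Measurable Δ' ∧
      (∀ᵐ x ∂(volume : Measure (Fin n₁ → ℝ)), Δ' (Δ x) = x) ∧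
      (∀ᵐ y ∂(volume : Measure (Fin n₂ → ℝ)), Δ (Δ' y) = y))
    (hΔns : (volume : Measure (Fin n₁ → ℝ)).map Δ ≪ (volume : Measure (Fin n₂ → ℝ)) ∧
      (volume : Measure (Fin n₂ → ℝ)) ≪ (volume : Measure (Fin n₁ → ℝ)).map Δ)
    (hequi : ∀ g : G₁, ∀ᵐ x ∂(volume : Measure (Fin n₁ → ℝ)),
      Δ (((g : Matrix.SpecialLinearGroup (Fin n₁) ℝ) : Matrix (Fin n₁) (Fin n₁) ℝ).mulVec x)
        = ((((δ g) : Matrix.SpecialLinearGroup (Fin n₂) ℝ) :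
            Matrix (Fin n₂) (Fin n₂) ℝ)).mulVec (Δ x)) :
    n₁ = n₂ ∧
    ∃! A : Matrix (Fin n₂) (Fin n₁) ℝ,
      (∃ B : Matrix (Fin n₁) (Fin n₂) ℝ, A * B = 1 ∧ B * A = 1) ∧
      (∀ᵐ x ∂(volume : Measure (Fin n₁ → ℝ)), Δ x = A.mulVec x) ∧
      ∀ g : G₁,
        (((δ g : Matrix.SpecialLinearGroup (Fin n₂) ℝ) : Matrix (Fin n₂) (Fin n₂) ℝ)) * A
          = A * ((g : Matrix.SpecialLinearGroup (Fin n₁) ℝ) : Matrix (Fin n₁) (Fin n₁) ℝ) := by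
  obtain ⟨E, hEm, i1, i2⟩ := hΔinv
  have q1 : Measure.QuasiMeasurePreserving Δ volume volume := ⟨hΔmeas, hΔns.1⟩
  have q2 : Measure.QuasiMeasurePreserving E volume volume := by
    refine ⟨hEm, Measure.AbsolutelyContinuous.mk fun s hs h0 => ?_⟩
    rw [Measure.map_apply hEm hs]
    apply hΔns.2
    rw [Measure.map_apply hΔmeas (hEm hs)]
    refine (measure_congr ?_).trans h0
    filter_upwards [i1] with x hx
    exact congrArg (· ∈ s) hx
  have c : DSL.Cj Δ E := ⟨q1, q2, i1, i2⟩
  have hR : ∀ g : G₁, DSL.R Δ (g : DSL.SL n₁) (δ g : DSL.SL n₂) := hequi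
  obtain ⟨hnm, A, hB, hA, hC⟩ := c.main hn₁ hn₂
    (DSL.R_exists q1 G₁ hd₁ fun g hg => ⟨_, hR ⟨g, hg⟩⟩)
    (DSL.R_exists q2 G₂ hd₂ fun g hg => ⟨δ.symm ⟨g, hg⟩, by
      have := c.R_symm (hR (δ.symm ⟨g, hg⟩))
      rwa [MulEquiv.apply_symm_apply] at this⟩)
  refine ⟨hnm, A, ⟨hB, hA, fun g => hC _ _ (hR g)⟩, ?_⟩
  rintro A' ⟨-, hA', -⟩
  have hae : (fun x => A'.mulVec x) =ᵐ[volume] fun x => A.mulVec x := by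
    filter_upwards [hA, hA'] with x a b
    exact b.symm.trans a
  have heq := (Continuous.ae_eq_iff_eq volume (continuous_const.matrix_mulVec continuous_id)
    (continuous_const.matrix_mulVec continuous_id)).1 hae
  exact Matrix.ext_of_mulVec_single fun i => congrFun heq _
end

section
/- Let n ≥ 2 and let G ⊆ SL(n,ℝ) be a countable dense subgroup acting on ℝⁿ (with Lebesgue measure λ) by matrix-vector multiplication. If T : ℝⁿ → ℝⁿ is a nonsingular automorphism such that for every g ∈ G, T(g·x) = g·T(x) for λ-a.e. x, then there exists a nonzero real number a such that T(x) = a·x for λ-a.e. x ∈ ℝⁿ. Consequently, the only measure-scaling one-parameter action of ℝ on ℝⁿ commuting with the G-action is t·x = e^{−t/n} x (up to reversing the parameter convention, the action scaling λ by e^{−t}). -/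
open MeasureTheory

namespace OESuperrigidity

/-- `f` defines an action of the additive group `ℝ` (a flow). -/
def IsFlow {Y : Type*} (f : ℝ → Y → Y) : Prop :=
  (∀ y, f 0 y = y) ∧ ∀ s t y, f (s + t) y = f s (f t y)

open Filter Topology Matrix in
lemma mp_of_det_one {n : ℕ} (M : Matrix (Fin n) (Fin n) ℝ) (hM : M.det = 1) :
    MeasurePreserving (fun x : Fin n → ℝ => M.mulVec x) volume volume := by
  refine ⟨by fun_prop, ?_⟩
  have := Real.map_matrix_volume_pi_eq_smul_volume_pi (M := M) (by simp [hM])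
  have h2 : Measure.map (fun x : Fin n → ℝ => M.mulVec x) volume
      = ENNReal.ofReal |M.det⁻¹| • volume := this
  rw [h2, hM]
  simp

open Filter Topology Matrix in
lemma closure_comm {n : ℕ} (T : (Fin n → ℝ) → (Fin n → ℝ)) (hT : Measurable T)
    (S : Set (Matrix (Fin n) (Fin n) ℝ)) (hS : ∀ g ∈ S, g.det = 1)
    (hc : ∀ g ∈ S, ∀ᵐ x ∂(volume : Measure (Fin n → ℝ)), T (g *ᵥ x) = g *ᵥ T x)
    (M : Matrix (Fin n) (Fin n) ℝ) (hM : M.det = 1) (hcl : M ∈ closure S) :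
    ∀ᵐ x ∂(volume : Measure (Fin n → ℝ)), T (M *ᵥ x) = M *ᵥ T x := by
  haveI : FirstCountableTopology (Matrix (Fin n) (Fin n) ℝ) :=
    inferInstanceAs (FirstCountableTopology (Fin n → Fin n → ℝ))
  obtain ⟨g, hgS, hg⟩ := mem_closure_iff_seq_limit.1 hcl
  suffices h : ∀ k, ∀ᵐ x ∂(volume : Measure (Fin n → ℝ)),
      Real.arctan (T (M *ᵥ x) k) = Real.arctan ((M *ᵥ T x) k) by
    filter_upwards [ae_all_iff.2 h] with x hx
    funext k
    exact Real.arctan_injective (hx k)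
  intro k
  have hmul : ∀ A : Matrix (Fin n) (Fin n) ℝ, Measurable (fun x : Fin n → ℝ => A *ᵥ x) :=
    fun A => by fun_prop
  have hbd : ∀ z : ℝ, ‖Real.arctan z‖ ≤ 2 := fun z => by
    rw [Real.norm_eq_abs, abs_le]
    constructor <;> linarith [Real.arctan_lt_pi_div_two z, Real.neg_pi_div_two_lt_arctan z,
      Real.pi_le_four]
  have hloc : ∀ F : (Fin n → ℝ) → ℝ, Measurable F →
      LocallyIntegrable (fun x => Real.arctan (F x)) := fun F hF => by
    refine (locallyIntegrable_const (2:ℝ)).mono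
      (Real.measurable_arctan.comp hF).aestronglyMeasurable (ae_of_all _ fun x => ?_)
    simpa using hbd (F x)
  refine ae_eq_of_integral_contDiff_smul_eq
    (hloc _ ((measurable_pi_apply k).comp (hT.comp (hmul M))))
    (hloc _ ((measurable_pi_apply k).comp ((hmul M).comp hT))) ?_
  intro ψ hψ hψc
  have hψcont : Continuous ψ := hψ.continuous
  obtain ⟨C, hC⟩ := hψcont.bounded_above_of_compact_support hψc
  have hC0 : 0 ≤ C := (norm_nonneg _).trans (hC 0)
  have hcv : ∀ A : Matrix (Fin n) (Fin n) ℝ, A.det = 1 →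
      ∫ x, ψ x • Real.arctan (T (A *ᵥ x) k)
        = ∫ y, ψ (A.adjugate *ᵥ y) • Real.arctan (T y k) := by
    intro A hA
    have hmp := mp_of_det_one A hA
    conv_rhs => rw [← hmp.map_eq]
    rw [integral_map hmp.measurable.aemeasurable]
    · simp [Matrix.mulVec_mulVec, Matrix.adjugate_mul, hA]
    · apply Measurable.aestronglyMeasurable
      exact (hψcont.measurable.comp (hmul _)).smul
        (Real.measurable_arctan.comp ((measurable_pi_apply k).comp hT))
  have hdetg : ∀ m, (g m).det = 1 := fun m => hS _ (hgS m)
  -- left limit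
  have hcompact : IsCompact ((fun p : Matrix (Fin n) (Fin n) ℝ × (Fin n → ℝ) => p.1 *ᵥ p.2) ''
      ((insert M (Set.range g)) ×ˢ tsupport ψ)) := by
    refine ((hg.isCompact_insert_range).prod hψc).image ?_
    exact Continuous.matrix_mulVec continuous_fst continuous_snd
  set K := ((fun p : Matrix (Fin n) (Fin n) ℝ × (Fin n → ℝ) => p.1 *ᵥ p.2) ''
      ((insert M (Set.range g)) ×ˢ tsupport ψ)) with hK
  have hL : Tendsto (fun m => ∫ x, ψ x • Real.arctan (T (g m *ᵥ x) k)) atTop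
      (𝓝 (∫ x, ψ x • Real.arctan (T (M *ᵥ x) k))) := by
    rw [hcv M hM]
    simp_rw [fun m => hcv (g m) (hdetg m)]
    refine tendsto_integral_of_dominated_convergence (K.indicator fun _ => C * 2) ?_ ?_ ?_ ?_
    · intro m
      apply Measurable.aestronglyMeasurable
      exact (hψcont.measurable.comp (hmul _)).smul
        (Real.measurable_arctan.comp ((measurable_pi_apply k).comp hT))
    · rw [integrable_indicator_iff hcompact.measurableSet]
      exact integrableOn_const hcompact.measure_lt_top.ne
    · intro m
      refine ae_of_all _ fun y => ?_
      by_cases hy : y ∈ K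
      · rw [Set.indicator_of_mem hy, norm_smul]
        exact mul_le_mul (hC _) (hbd _) (norm_nonneg _) hC0
      · rw [Set.indicator_of_notMem hy]
        have : ψ ((g m).adjugate *ᵥ y) = 0 := by
          by_contra hne
          apply hy
          refine ⟨(g m, (g m).adjugate *ᵥ y), ⟨Or.inr ⟨m, rfl⟩, subset_tsupport _ hne⟩, ?_⟩
          simp [Matrix.mulVec_mulVec, Matrix.mul_adjugate, hdetg m]
        simp [this]
    · refine ae_of_all _ fun y => ?_
      refine Tendsto.smul_const ?_ _
      have hcont : Continuous fun A : Matrix (Fin n) (Fin n) ℝ => ψ (A.adjugate *ᵥ y) :=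
        hψcont.comp ((Continuous.matrix_adjugate continuous_id).matrix_mulVec continuous_const)
      exact (hcont.tendsto M).comp hg
  have hR : Tendsto (fun m => ∫ x, ψ x • Real.arctan (T (g m *ᵥ x) k)) atTop
      (𝓝 (∫ x, ψ x • Real.arctan ((M *ᵥ T x) k))) := by
    have he : ∀ m, ∫ x, ψ x • Real.arctan (T (g m *ᵥ x) k)
        = ∫ x, ψ x • Real.arctan ((g m *ᵥ T x) k) := fun m => by
      apply integral_congr_ae
      filter_upwards [hc _ (hgS m)] with x hx
      rw [hx]
    simp_rw [he]
    refine tendsto_integral_of_dominated_convergence (fun x => ‖ψ x‖ * 2) ?_ ?_ ?_ ?_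
    · intro m
      apply Measurable.aestronglyMeasurable
      exact hψcont.measurable.smul
        (Real.measurable_arctan.comp ((measurable_pi_apply k).comp ((hmul _).comp hT)))
    · exact ((hψcont.integrable_of_hasCompactSupport hψc).norm).mul_const 2
    · intro m
      refine ae_of_all _ fun y => ?_
      rw [norm_smul]
      exact mul_le_mul_of_nonneg_left (hbd _) (norm_nonneg _)
    · refine ae_of_all _ fun y => ?_
      refine Tendsto.const_smul ?_ _
      have hcont : Continuous fun A : Matrix (Fin n) (Fin n) ℝ => Real.arctan ((A *ᵥ T y) k) :=
        Real.continuous_arctan.comp ((continuous_apply k).comp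
          (continuous_id.matrix_mulVec continuous_const))
      exact (hcont.tendsto M).comp hg
  exact tendsto_nhds_unique hL hR

/-- Shear commutation, rewritten as translation. -/
lemma shear {n : ℕ} (T : (Fin n → ℝ) → (Fin n → ℝ)) (hT : Measurable T) (i j : Fin n)
    (h : ∀ t : ℝ, ∀ᵐ x ∂(volume : Measure (Fin n → ℝ)),
      T (x + Pi.single i (t * x j)) = T x + Pi.single i (t * T x j)) :
    ∀ᵐ y : ℝ, ∀ᵐ x ∂(volume : Measure (Fin n → ℝ)),
      T (x + Pi.single i y) = T x + Pi.single i (y * (T x j / x j)) := by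
  have hs : Measurable (fun y : ℝ => (Pi.single i y : Fin n → ℝ)) := by
    exact (continuous_single i).measurable
  have hTj : Measurable fun x => T x j := (measurable_pi_apply j).comp hT
  have m1 : MeasurableSet {p : ℝ × (Fin n → ℝ) |
      T (p.2 + Pi.single i (p.1 * p.2 j)) = T p.2 + Pi.single i (p.1 * T p.2 j)} := by
    apply measurableSet_eq_fun
    · exact hT.comp (measurable_snd.add (hs.comp (by fun_prop)))
    · exact (hT.comp measurable_snd).add (hs.comp (by fun_prop))
  have m2 : MeasurableSet {p : ℝ × (Fin n → ℝ) |
      T (p.2 + Pi.single i p.1) = T p.2 + Pi.single i (p.1 * (T p.2 j / p.2 j))} := by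
    apply measurableSet_eq_fun
    · exact hT.comp (measurable_snd.add (hs.comp (by fun_prop)))
    · exact (hT.comp measurable_snd).add (hs.comp (by fun_prop))
  have h1 := (Measure.ae_ae_comm m1).1 (ae_of_all volume h)
  refine (Measure.ae_ae_comm m2).2 ?_
  have hne : ∀ᵐ x ∂(volume : Measure (Fin n → ℝ)), x j ≠ 0 :=
    (Measure.quasiMeasurePreserving_eval (fun _ : Fin n => (volume : Measure ℝ)) j).ae
      (p := fun s => s ≠ 0) (by simp [ae_iff])
  filter_upwards [h1, hne] with x hx hxj
  have hq : Measure.QuasiMeasurePreserving (fun y : ℝ => (x j)⁻¹ • y) volume volume :=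
    Measure.quasiMeasurePreserving_smul (μ := (volume : Measure ℝ)) (inv_ne_zero hxj)
  filter_upwards [hq.ae hx] with y hy
  have e1 : (x j)⁻¹ • y * x j = y := by simp; field_simp
  have e2 : (x j)⁻¹ • y * T x j = y * (T x j / x j) := by simp; field_simp
  rwa [e1, e2] at hy

lemma const_of_translation {n : ℕ} (F : (Fin n → ℝ) → ℝ) (hF : Measurable F)
    (h : ∀ i, ∀ᵐ y : ℝ, ∀ᵐ x ∂(volume : Measure (Fin n → ℝ)), F (x + Pi.single i y) = F x) :
    ∃ a, ∀ᵐ x ∂(volume : Measure (Fin n → ℝ)), F x = a := by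
  have h1 : ∀ᵐ v ∂(volume : Measure (Fin n → ℝ)), ∀ i,
      ∀ᵐ x ∂(volume : Measure (Fin n → ℝ)), F (x + Pi.single i (v i)) = F x :=
    ae_all_iff.2 fun i =>
      (Measure.quasiMeasurePreserving_eval (fun _ : Fin n => (volume : Measure ℝ)) i).ae (h i)
  have h2 : ∀ᵐ v ∂(volume : Measure (Fin n → ℝ)),
      ∀ᵐ x ∂(volume : Measure (Fin n → ℝ)), F (x + v) = F x := by
    filter_upwards [h1] with v hv
    have : ∀ s : Finset (Fin n), ∀ᵐ x ∂(volume : Measure (Fin n → ℝ)),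
        F (x + ∑ i ∈ s, Pi.single i (v i)) = F x := by
      intro s
      induction s using Finset.induction_on with
      | empty => simp
      | insert i s hi ih =>
        have := (measurePreserving_add_right (volume : Measure (Fin n → ℝ))
          (∑ i ∈ s, Pi.single i (v i))).quasiMeasurePreserving.ae (hv i)
        filter_upwards [this, ih] with x hx hx'
        rw [Finset.sum_insert hi, ← add_assoc, add_right_comm, hx, hx']
    have h3 := this Finset.univ
    rwa [Finset.univ_sum_single v] at h3
  have m : MeasurableSet {p : (Fin n → ℝ) × (Fin n → ℝ) | F (p.2 + p.1) = F p.2} :=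
    measurableSet_eq_fun (by fun_prop) (by fun_prop)
  obtain ⟨x, hx⟩ := ((Measure.ae_ae_comm m).1 h2).exists
  refine ⟨F x, ?_⟩
  have := (measurePreserving_add_left (volume : Measure (Fin n → ℝ))
          (-x)).quasiMeasurePreserving.ae hx
  filter_upwards [this] with y hy
  simpa using hy

lemma part_one {n : ℕ} (hn : 2 ≤ n) (T : (Fin n → ℝ) → (Fin n → ℝ)) (hT : Measurable T)
    (hac : (volume : Measure (Fin n → ℝ)).map T ≪ volume)
    (h : ∀ M : Matrix (Fin n) (Fin n) ℝ, M.det = 1 →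
      ∀ᵐ x ∂(volume : Measure (Fin n → ℝ)), T (M.mulVec x) = M.mulVec (T x)) :
    ∃ a : ℝ, a ≠ 0 ∧ ∀ᵐ x ∂(volume : Measure (Fin n → ℝ)), T x = a • x := by
  haveI : Nontrivial (Fin n) := Fin.nontrivial_iff_two_le.2 hn
  have hne : ∀ j, ∀ᵐ x ∂(volume : Measure (Fin n → ℝ)), x j ≠ 0 := fun j =>
    (Measure.quasiMeasurePreserving_eval (fun _ : Fin n => (volume : Measure ℝ)) j).ae
      (p := fun s => s ≠ 0) (by simp [ae_iff])
  have hS : ∀ i j, i ≠ j → ∀ᵐ y : ℝ, ∀ᵐ x ∂(volume : Measure (Fin n → ℝ)),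
      T (x + Pi.single i y) = T x + Pi.single i (y * (T x j / x j)) := by
    intro i j hij
    apply shear T hT
    intro t
    have hmv : ∀ x : Fin n → ℝ, (Matrix.transvection i j t).mulVec x
        = x + Pi.single i (t * x j) := by
      intro x
      simp [Matrix.transvection, Matrix.add_mulVec, Matrix.single_mulVec, Pi.single, Function.update]
    have := h (Matrix.transvection i j t) (Matrix.det_transvection_of_ne i j hij t)
    simpa only [hmv] using this
  have hinv : ∀ i k, i ≠ k → ∀ᵐ y : ℝ, ∀ᵐ x ∂(volume : Measure (Fin n → ℝ)),
      T (x + Pi.single i y) k = T x k := by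
    intro i k hik
    filter_upwards [hS i k hik] with y hy
    filter_upwards [hy] with x hx
    rw [hx]
    simp [hik.symm]
  have hconst : ∀ j, ∃ a, ∀ᵐ x ∂(volume : Measure (Fin n → ℝ)), T x j / x j = a := by
    intro j
    apply const_of_translation (fun x => T x j / x j)
    · exact ((measurable_pi_apply j).comp hT).div (measurable_pi_apply j)
    intro k
    by_cases hkj : k = j
    · subst hkj
      obtain ⟨i, hik⟩ := exists_ne k
      obtain ⟨y, hy, hy0⟩ := ((hS i k hik).and
        (show ∀ᵐ y : ℝ, y ≠ 0 by simp [ae_iff])).exists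
      filter_upwards [hinv k i hik.symm] with s hs
      have t1 := (measurePreserving_add_right (volume : Measure (Fin n → ℝ))
          (Pi.single k s)).quasiMeasurePreserving.ae hy
      have t2 := (measurePreserving_add_right (volume : Measure (Fin n → ℝ))
          (Pi.single i y)).quasiMeasurePreserving.ae hs
      filter_upwards [hy, hs, t1, t2] with x h1 h2 h3 h4
      have h1' := congrFun h1 i
      have h3' := congrFun h3 i
      rw [add_right_comm, h4] at h3'
      simp only [Pi.add_apply, Pi.single_eq_same] at h1' h3' ⊢
      rw [h1', h2] at h3'
      exact (mul_left_cancel₀ hy0 (add_left_cancel h3')).symm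
    · filter_upwards [hinv k j hkj] with y hy
      filter_upwards [hy] with x hx
      simp [hx, Ne.symm hkj]
  choose a ha using hconst
  have hTa : ∀ᵐ x ∂(volume : Measure (Fin n → ℝ)), ∀ j, T x j = a j * x j := by
    rw [ae_all_iff]
    intro j
    filter_upwards [ha j, hne j] with x h1 h2
    rw [← h1]; field_simp
  have haa : ∀ i j, a i = a j := by
    intro i j
    by_cases hij : i = j
    · rw [hij]
    obtain ⟨y, hy, hy0⟩ := ((hS i j hij).and
        (show ∀ᵐ y : ℝ, y ≠ 0 by simp [ae_iff])).exists
    have t2 := (measurePreserving_add_right (volume : Measure (Fin n → ℝ))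
          (Pi.single i y)).quasiMeasurePreserving.ae hTa
    obtain ⟨x, h1, h2, h3, h4⟩ := (hy.and (hTa.and (t2.and (ha j)))).exists
    have h1' := congrFun h1 i
    rw [h3 i, h4] at h1'
    simp only [Pi.add_apply, Pi.single_eq_same] at h1'
    rw [h2 i] at h1'
    apply mul_left_cancel₀ hy0
    linarith
  obtain ⟨i0, -⟩ := exists_pair_ne (Fin n)
  have hfin : ∀ᵐ x ∂(volume : Measure (Fin n → ℝ)), T x = a i0 • x := by
    filter_upwards [hTa] with x hx
    funext j
    rw [hx j, haa j i0]; rfl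
  refine ⟨a i0, ?_, hfin⟩
  intro h0
  have hnz : ∀ᵐ x ∂(volume : Measure (Fin n → ℝ)), T x i0 ≠ 0 :=
    ae_of_ae_map hT.aemeasurable (hac.ae_le (hne i0))
  obtain ⟨x, h1, h2⟩ := (hfin.and hnz).exists
  apply h2
  rw [h1, h0]; simp

/-- Let `G ⊆ SL(n,ℝ)` be a countable dense subgroup, `n ≥ 2`. Every
nonsingular automorphism `T` of `ℝⁿ` commuting a.e. with the linear `G`-action is a.e. of the
form `T(x) = a·x` for some nonzero real `a`; consequently, the unique one-parameter action of
`ℝ` on `ℝⁿ` commuting with the `G`-action and scaling Lebesgue measure (pushing `λ` forward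
to `e^t λ`) is `t · x = e^{-t/n} x`. -/
theorem commutant_of_dense_subgroup_is_scaling
    (n : ℕ) (hn : 2 ≤ n)
    (G : Subgroup (Matrix.SpecialLinearGroup (Fin n) ℝ)) (hcount : Countable G)
    (hdense : ∀ M : Matrix.SpecialLinearGroup (Fin n) ℝ,
      (M : Matrix (Fin n) (Fin n) ℝ) ∈
        closure {x : Matrix (Fin n) (Fin n) ℝ |
          ∃ g ∈ G, (g : Matrix (Fin n) (Fin n) ℝ) = x}) :
    (∀ T : (Fin n → ℝ) → (Fin n → ℝ), Measurable T →
      (∃ T' : (Fin n → ℝ) → (Fin n → ℝ), Measurable T' ∧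
        (∀ᵐ x ∂(volume : Measure (Fin n → ℝ)), T' (T x) = x) ∧
        (∀ᵐ x ∂(volume : Measure (Fin n → ℝ)), T (T' x) = x)) →
      ((volume : Measure (Fin n → ℝ)).map T ≪ (volume : Measure (Fin n → ℝ)) ∧
        (volume : Measure (Fin n → ℝ)) ≪ (volume : Measure (Fin n → ℝ)).map T) →
      (∀ g : G, ∀ᵐ x ∂(volume : Measure (Fin n → ℝ)),
        T (((g : Matrix.SpecialLinearGroup (Fin n) ℝ) : Matrix (Fin n) (Fin n) ℝ).mulVec x)
          = ((g : Matrix.SpecialLinearGroup (Fin n) ℝ) :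
              Matrix (Fin n) (Fin n) ℝ).mulVec (T x)) →
      ∃ a : ℝ, a ≠ 0 ∧ ∀ᵐ x ∂(volume : Measure (Fin n → ℝ)), T x = a • x) ∧
    (∀ f : ℝ → (Fin n → ℝ) → (Fin n → ℝ), IsFlow f → (∀ t, Measurable (f t)) →
      (∀ t : ℝ, (volume : Measure (Fin n → ℝ)).map (f t)
        = ENNReal.ofReal (Real.exp t) • (volume : Measure (Fin n → ℝ))) →
      (∀ (t : ℝ) (g : G), ∀ᵐ x ∂(volume : Measure (Fin n → ℝ)),
        f t (((g : Matrix.SpecialLinearGroup (Fin n) ℝ) : Matrix (Fin n) (Fin n) ℝ).mulVec x)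
          = ((g : Matrix.SpecialLinearGroup (Fin n) ℝ) :
              Matrix (Fin n) (Fin n) ℝ).mulVec (f t x)) →
      ∀ t : ℝ, ∀ᵐ x ∂(volume : Measure (Fin n → ℝ)),
        f t x = Real.exp (-t / n) • x) := by
  have key : ∀ T : (Fin n → ℝ) → (Fin n → ℝ), Measurable T →
      (volume : Measure (Fin n → ℝ)).map T ≪ (volume : Measure (Fin n → ℝ)) →
      (∀ g : G, ∀ᵐ x ∂(volume : Measure (Fin n → ℝ)),
        T (((g : Matrix.SpecialLinearGroup (Fin n) ℝ) : Matrix (Fin n) (Fin n) ℝ).mulVec x)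
          = ((g : Matrix.SpecialLinearGroup (Fin n) ℝ) :
              Matrix (Fin n) (Fin n) ℝ).mulVec (T x)) →
      ∃ a : ℝ, a ≠ 0 ∧ ∀ᵐ x ∂(volume : Measure (Fin n → ℝ)), T x = a • x := by
    intro T hT hac hc
    refine part_one hn T hT hac fun M hM => ?_
    refine closure_comm T hT _ ?_ ?_ M hM (hdense ⟨M, hM⟩)
    · rintro _ ⟨g, -, rfl⟩
      exact g.2
    · rintro _ ⟨g, hg, rfl⟩
      exact hc ⟨g, hg⟩
  refine ⟨fun T hT _ hac hc => key T hT hac.1 hc, ?_⟩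
  intro f hf hm hsc hc t
  have hac : ∀ t, (volume : Measure (Fin n → ℝ)).map (f t) ≪ volume := fun t => by
    rw [hsc t]; exact Measure.smul_absolutelyContinuous
  have hk := fun t => key (f t) (hm t) (hac t) (hc t)
  choose a ha0 ha using hk
  have hpos : 0 < a t := by
    have hq : Measure.QuasiMeasurePreserving (f (t / 2)) volume volume := ⟨hm _, hac _⟩
    have hne : ∀ᵐ x ∂(volume : Measure (Fin n → ℝ)), x ⟨0, by omega⟩ ≠ 0 :=
      (Measure.quasiMeasurePreserving_eval (fun _ : Fin n => (volume : Measure ℝ)) _).ae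
        (p := fun s => s ≠ 0) (by simp [ae_iff])
    obtain ⟨x, h1, h2, h3, h4⟩ :=
      ((ha t).and ((ha (t / 2)).and ((hq.ae (ha (t / 2))).and hne))).exists
    have h5 := hf.2 (t / 2) (t / 2) x
    rw [add_halves, h1, h3, h2, smul_smul] at h5
    have h6 := congrFun h5 ⟨0, by omega⟩
    simp only [Pi.smul_apply, smul_eq_mul] at h6
    rw [mul_right_cancel₀ h4 h6]
    exact mul_self_pos.2 (ha0 _)
  have hmap : ENNReal.ofReal (Real.exp t) • (volume : Measure (Fin n → ℝ))
      = ENNReal.ofReal |((a t) ^ n)⁻¹| • (volume : Measure (Fin n → ℝ)) := by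
    rw [← hsc t, Measure.map_congr (ha t)]
    simpa using Measure.map_addHaar_smul (volume : Measure (Fin n → ℝ)) (ha0 t)
  have hv : (volume : Measure (Fin n → ℝ)) (Set.pi Set.univ fun _ => Set.Icc 0 1) = 1 := by
    rw [volume_pi_pi]
    simp
  have h1 := congrArg (fun μ : Measure (Fin n → ℝ) => μ (Set.pi Set.univ fun _ => Set.Icc 0 1)) hmap
  simp only [Measure.smul_apply, hv, smul_eq_mul, mul_one] at h1
  rw [ENNReal.ofReal_eq_ofReal_iff (Real.exp_pos t).le (abs_nonneg _),
    abs_of_pos (by positivity)] at h1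
  have hn0 : (n : ℝ) ≠ 0 := by positivity
  have hat : a t = Real.exp (-t / n) := by
    have h2 := congrArg Real.log h1
    rw [Real.log_exp, Real.log_inv, Real.log_pow] at h2
    rw [← Real.exp_log hpos]
    congr 1
    field_simp
    linarith
  rw [← hat]
  exact ha t

end OESuperrigidity
end

section
/- Let n ≥ 2 and let 𝒜₁ ⊆ ℝ be a subring (containing 1). Then the smallest subring of the ring M_n(ℝ) of n×n real matrices that contains E(n,𝒜₁) equals {M ∈ M_n(ℝ) : every entry of M lies in 𝒜₁}. -/
namespace OESuperrigidity

/-- The elementary matrices `e_{ij}(a)`, `i ≠ j`, `a ∈ 𝒜`, viewed inside `SL(n,ℝ)`. -/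
def elementarySet (n : ℕ) (A : Subring ℝ) : Set (Matrix.SpecialLinearGroup (Fin n) ℝ) :=
  {g | ∃ i j : Fin n, i ≠ j ∧ ∃ a : ℝ, a ∈ A ∧
    (g : Matrix (Fin n) (Fin n) ℝ) = Matrix.transvection i j a}

/-- `E(n,𝒜)`: the subgroup of `SL(n,ℝ)` generated by the elementary matrices with
off-diagonal entry in the subring `𝒜 ⊆ ℝ`. -/
def En (n : ℕ) (A : Subring ℝ) : Subgroup (Matrix.SpecialLinearGroup (Fin n) ℝ) :=
  Subgroup.closure (elementarySet n A)

end OESuperrigidity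

namespace OESuperrigidity

/-- For `n ≥ 2` and a subring `𝒜₁ ⊆ ℝ`, the smallest subring of the ring of
`n × n` real matrices containing `E(n,𝒜₁)` is the set of matrices with all entries in `𝒜₁`. -/
theorem subring_closure_elementary_eq_entries
    (n : ℕ) (hn : 2 ≤ n) (A₁ : Subring ℝ) :
    (Subring.closure
        {M : Matrix (Fin n) (Fin n) ℝ | ∃ g ∈ En n A₁, (g : Matrix (Fin n) (Fin n) ℝ) = M}
      : Set (Matrix (Fin n) (Fin n) ℝ))
      = {M : Matrix (Fin n) (Fin n) ℝ | ∀ i j : Fin n, M i j ∈ A₁} := by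
  classical
  apply Set.Subset.antisymm
  · let S : Subring (Matrix (Fin n) (Fin n) ℝ) := (A₁.subtype.mapMatrix (m := Fin n)).range
    have hS : ∀ M ∈ S, ∀ i j, M i j ∈ A₁ := by
      rintro _ ⟨N, rfl⟩ i j
      exact (N i j).2
    have hE : En n A₁ ≤ (Matrix.SpecialLinearGroup.map (n := Fin n) A₁.subtype).range := by
      unfold En
      rw [Subgroup.closure_le]
      rintro g ⟨i, j, hij, a, ha, hg⟩
      refine ⟨⟨Matrix.transvection i j (⟨a, ha⟩ : A₁),
        Matrix.det_transvection_of_ne i j hij _⟩, ?_⟩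
      apply Subtype.ext
      rw [hg]
      ext k l
      change A₁.subtype ((Matrix.transvection i j (⟨a, ha⟩ : A₁)) k l) = _
      simp only [Matrix.transvection, Matrix.add_apply, Matrix.one_apply,
        Matrix.single_apply]
      split_ifs <;> simp
    intro M hM
    apply hS
    refine (Subring.closure_le.2 ?_ : Subring.closure _ ≤ S) hM
    rintro _ ⟨g, hg, rfl⟩
    obtain ⟨h, rfl⟩ := hE hg
    exact ⟨h.1, rfl⟩
  · intro M hM
    simp only [SetLike.mem_coe]
    set T := Subring.closure
        {M : Matrix (Fin n) (Fin n) ℝ | ∃ g ∈ En n A₁, (g : Matrix (Fin n) (Fin n) ℝ) = M} with hT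
    have h1 : ∀ i j : Fin n, i ≠ j → ∀ a ∈ A₁, Matrix.single i j a ∈ T := by
      intro i j hij a ha
      have h : Matrix.transvection i j a ∈ T := Subring.subset_closure
        ⟨⟨Matrix.transvection i j a, Matrix.det_transvection_of_ne i j hij a⟩,
          Subgroup.subset_closure ⟨i, j, hij, a, ha, rfl⟩, rfl⟩
      have h2 := T.sub_mem h T.one_mem
      simpa [Matrix.transvection] using h2
    have h2 : ∀ i j : Fin n, ∀ a ∈ A₁, Matrix.single i j a ∈ T := by
      intro i j a ha
      by_cases hij : i = j
      · subst hij
        have : Nontrivial (Fin n) := Fin.nontrivial_iff_two_le.2 hn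
        obtain ⟨k, hk⟩ := exists_ne i
        have := T.mul_mem (h1 i k hk.symm a ha) (h1 k i hk 1 A₁.one_mem)
        simpa using this
      · exact h1 i j hij a ha
    rw [Matrix.matrix_eq_sum_single M]
    exact T.sum_mem fun i _ => T.sum_mem fun j _ => h2 i j _ (hM i j)

end OESuperrigidity
end

section
/- Let n ≥ 3, let 𝒜, 𝒜′ ⊆ ℝ be subrings, and let B ∈ GL(n,ℝ) be such that B·E(n,𝒜)·B⁻¹ = E(n,𝒜′). Then 𝒜 = 𝒜′. -/
namespace OESuperrigidity

theorem En_entries (n : ℕ) (A : Subring ℝ) (g : Matrix.SpecialLinearGroup (Fin n) ℝ)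
    (hg : g ∈ En n A) (k l : Fin n) : (g : Matrix (Fin n) (Fin n) ℝ) k l ∈ A := by
  have h : En n A ≤ (Matrix.SpecialLinearGroup.map (n := Fin n) A.subtype).range := by
    refine (Subgroup.closure_le _).2 ?_
    rintro g ⟨i, j, hij, a, ha, hg⟩
    refine ⟨⟨Matrix.transvection i j ⟨a, ha⟩, Matrix.det_transvection_of_ne i j hij _⟩, ?_⟩
    apply Subtype.ext
    rw [hg]
    ext k l
    change ((Matrix.transvection i j (⟨a, ha⟩ : A) k l : A) : ℝ) = Matrix.transvection i j a k l
    rw [Matrix.transvection, Matrix.transvection, Matrix.add_apply, Matrix.add_apply,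
      Matrix.one_apply, Matrix.one_apply, Matrix.single_apply, Matrix.single_apply]
    split_ifs <;> simp
  obtain ⟨m, rfl⟩ := h hg
  exact (m.1 k l).2

theorem En_aux (n : ℕ) (hn : 3 ≤ n) (A A' : Subring ℝ) (B C : Matrix (Fin n) (Fin n) ℝ)
    (hBC : B * C = 1) (hCB : C * B = 1)
    (h : ∀ g ∈ En n A, ∃ g' ∈ En n A',
      B * (g : Matrix (Fin n) (Fin n) ℝ) * C = (g' : Matrix (Fin n) (Fin n) ℝ)) :
    A ≤ A' := by
  have h1 : ∀ i j : Fin n, i ≠ j → ∀ a ∈ A, ∀ k l,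
      (B * Matrix.single i j a * C) k l ∈ A' := by
    intro i j hij a ha k l
    obtain ⟨g', hg', he⟩ := h ⟨Matrix.transvection i j a, Matrix.det_transvection_of_ne i j hij a⟩
      (Subgroup.subset_closure ⟨i, j, hij, a, ha, rfl⟩)
    have e : B * Matrix.single i j a * C = (g' : Matrix (Fin n) (Fin n) ℝ) - 1 := by
      rw [← he]
      simp [Matrix.transvection, Matrix.mul_add, Matrix.add_mul, hBC]
    rw [e, Matrix.sub_apply]
    refine A'.sub_mem (En_entries n A' g' hg' k l) ?_
    rw [Matrix.one_apply]
    split_ifs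
    · exact A'.one_mem
    · exact A'.zero_mem
  have h2 : ∀ i : Fin n, ∀ a ∈ A, ∀ k l, (B * Matrix.single i i a * C) k l ∈ A' := by
    intro i a ha k l
    have : Nontrivial (Fin n) := Fin.nontrivial_iff_two_le.2 (by omega)
    obtain ⟨j, hj⟩ := exists_ne i
    have e : B * Matrix.single i i a * C
        = (B * Matrix.single i j a * C) * (B * Matrix.single j i 1 * C) := by
      calc _ = B * (Matrix.single i j a * Matrix.single j i 1) * C := by simp
        _ = B * Matrix.single i j a * (C * B) * Matrix.single j i 1 * C := by
          rw [hCB]; simp only [Matrix.mul_assoc, Matrix.one_mul]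
        _ = _ := by simp only [Matrix.mul_assoc]
    rw [e, Matrix.mul_apply]
    exact A'.sum_mem fun m _ => A'.mul_mem (h1 i j hj.symm a ha _ _)
      (h1 j i hj 1 A.one_mem _ _)
  intro a ha
  have e : (∑ i, B * Matrix.single i i a * C : Matrix (Fin n) (Fin n) ℝ) = Matrix.diagonal fun _ => a := by
    rw [← Finset.sum_mul, ← Finset.mul_sum, Matrix.sum_single_eq_diagonal (fun _ => a)]
    rw [← Matrix.smul_one_eq_diagonal]
    simp [hBC]
  let z : Fin n := ⟨0, by omega⟩
  have e2 : a = (∑ i, B * Matrix.single i i a * C : Matrix (Fin n) (Fin n) ℝ) z z := by rw [e]; simp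
  rw [e2, Matrix.sum_apply]
  exact A'.sum_mem fun i _ => h2 i a ha z z

/-- For `n ≥ 3`, if `B ∈ GL(n,ℝ)` satisfies `B · E(n,𝒜) · B⁻¹ = E(n,𝒜′)`,
then `𝒜 = 𝒜′`. -/
theorem subring_eq_of_conjugate_elementary_groups
    (n : ℕ) (hn : 3 ≤ n) (A A' : Subring ℝ) (B : Matrix.GeneralLinearGroup (Fin n) ℝ)
    (hconj :
      (fun M : Matrix (Fin n) (Fin n) ℝ =>
          (B : Matrix (Fin n) (Fin n) ℝ) * M * ((B⁻¹ : Matrix.GeneralLinearGroup (Fin n) ℝ) :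
            Matrix (Fin n) (Fin n) ℝ)) ''
        {M : Matrix (Fin n) (Fin n) ℝ | ∃ g ∈ En n A, (g : Matrix (Fin n) (Fin n) ℝ) = M}
      = {M : Matrix (Fin n) (Fin n) ℝ | ∃ g ∈ En n A', (g : Matrix (Fin n) (Fin n) ℝ) = M}) :
    A = A' := by
  have hBC : (B : Matrix (Fin n) (Fin n) ℝ) * ((B⁻¹ : Matrix.GeneralLinearGroup (Fin n) ℝ) :
      Matrix (Fin n) (Fin n) ℝ) = 1 := Units.mul_inv B
  have hCB : ((B⁻¹ : Matrix.GeneralLinearGroup (Fin n) ℝ) :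
      Matrix (Fin n) (Fin n) ℝ) * (B : Matrix (Fin n) (Fin n) ℝ) = 1 := Units.inv_mul B
  apply le_antisymm
  · refine En_aux n hn A A' _ _ hBC hCB fun g hg => ?_
    obtain ⟨g', hg', he⟩ := hconj.subset ⟨_, ⟨g, hg, rfl⟩, rfl⟩
    exact ⟨g', hg', he.symm⟩
  · refine En_aux n hn A' A _ _ hCB hBC fun g hg => ?_
    obtain ⟨_, ⟨g', hg', rfl⟩, he⟩ := hconj.symm.subset ⟨g, hg, rfl⟩
    refine ⟨g', hg', ?_⟩
    rw [← he]
    simp only [← Matrix.mul_assoc, hCB, Matrix.one_mul]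
    rw [Matrix.mul_assoc, hCB, Matrix.mul_one]

end OESuperrigidity
end

section
/- Let K ⊆ ℝ be an algebraic number field with [K:ℚ] ≥ 2, let 𝒪_K be its ring of integers, and let n be a positive integer. Let I(K) denote the multiplicative group of invertible fractional ideals of 𝒪_K in K. Define the subgroup X_n(K) = {(𝔞,α) ∈ I(K) × K^× : 𝔞ⁿ = α·𝒪_K} of I(K) × K^×, and its subgroup Y_n(K) = {(β·𝒪_K, βⁿ) : β ∈ K^×}. Then the quotient group X_n(K)/Y_n(K) is isomorphic to (𝒪_K^× / (𝒪_K^×)ⁿ) × Cl_n(K), where Cl_n(K) = {J in the ideal class group of K : Jⁿ = 1} is the n-torsion subgroup of the ideal class group of K. -/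
open scoped nonZeroDivisors NumberField

namespace OESuperrigidity

variable (K : Subfield ℝ) [NumberField ↥K] (n : ℕ)

/-- `X_n(K) = {(𝔞,α) ∈ I(K) × K^× : 𝔞ⁿ = α·𝒪_K}`, a subgroup of `I(K) × K^×`, where `I(K)`
is the group of invertible fractional ideals of `𝒪_K` in `K`. -/
noncomputable def Xn : Subgroup ((FractionalIdeal (𝓞 ↥K)⁰ ↥K)ˣ × (↥K)ˣ) where
  carrier := {p | p.1 ^ n = toPrincipalIdeal (𝓞 ↥K) ↥K p.2}
  one_mem' := by simp
  mul_mem' := by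
    intro p q hp hq
    simp only [Set.mem_setOf_eq] at hp hq ⊢
    rw [Prod.fst_mul, Prod.snd_mul, mul_pow, map_mul, hp, hq]
  inv_mem' := by
    intro p hp
    simp only [Set.mem_setOf_eq] at hp ⊢
    rw [Prod.fst_inv, Prod.snd_inv, inv_pow, map_inv, hp]

/-- `Y_n(K) = {(β·𝒪_K, βⁿ) : β ∈ K^×}`, a subgroup of `I(K) × K^×`. -/
noncomputable def Yn : Subgroup ((FractionalIdeal (𝓞 ↥K)⁰ ↥K)ˣ × (↥K)ˣ) :=
  ((toPrincipalIdeal (𝓞 ↥K) ↥K).prod (powMonoidHom n)).range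

theorem exists_section {G C : Type*} [CommGroup G] [CommGroup C] [Finite C] (π : G →* C)
    (h : ∀ c : C, ∃ g : G, π g = c ∧ g ^ orderOf c = 1) :
    ∃ s : C →* G, ∀ c, π (s c) = c := by
  classical
  obtain ⟨ι, _, d, hd, ⟨e⟩⟩ := CommGroup.equiv_prod_multiplicative_zmod_of_finite C
  let c : ι → C := fun i => e.symm (Pi.mulSingle i (Multiplicative.ofAdd 1))
  have hc : ∀ i, c i ^ d i = 1 := by
    intro i
    have : (Multiplicative.ofAdd (1 : ZMod (d i))) ^ d i = 1 := by
      rw [← ofAdd_nsmul]; simp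
    simp only [c]
    rw [← map_pow, ← Pi.mulSingle_pow, this]; simp
  choose g hg hg' using fun i => h (c i)
  have hgd : ∀ i, g i ^ d i = 1 := by
    intro i
    obtain ⟨k, hk⟩ := orderOf_dvd_of_pow_eq_one (hc i)
    rw [hk, pow_mul, hg', one_pow]
  let φ : ∀ i, Multiplicative (ZMod (d i)) →* G := fun i =>
    AddMonoidHom.toMultiplicativeLeft (ZMod.lift (d i)
      ⟨zmultiplesHom (Additive G) (Additive.ofMul (g i)), by
        simp [← ofMul_pow, hgd]⟩)
  have hφ : ∀ i (k : ℤ), φ i (Multiplicative.ofAdd (k : ZMod (d i))) = g i ^ k := by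
    intro i k
    simp [φ]
  let f : (∀ i, Multiplicative (ZMod (d i))) →* G :=
    { toFun := fun x => ∏ i, φ i (x i)
      map_one' := by simp
      map_mul' := by intro x y; simp [Finset.prod_mul_distrib] }
  refine ⟨f.comp e.toMonoidHom, fun x => ?_⟩
  obtain ⟨y, rfl⟩ := e.symm.surjective x
  have : ∀ i, π (φ i (y i)) = e.symm (Pi.mulSingle i (y i)) := by
    intro i
    obtain ⟨k, hk⟩ := ZMod.intCast_surjective (Multiplicative.toAdd (y i))
    have hy : y i = Multiplicative.ofAdd (k : ZMod (d i)) := by rw [hk]; rfl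
    rw [hy, hφ, map_zpow, hg]
    simp only [c]
    rw [← map_zpow, ← Pi.mulSingle_zpow, ← ofAdd_zsmul]
    simp
  simp only [MonoidHom.comp_apply, MulEquiv.coe_toMonoidHom, MulEquiv.apply_symm_apply, f,
    MonoidHom.coe_mk, OneHom.coe_mk, map_prod, this]
  rw [← map_prod, Finset.univ_prod_mulSingle]

theorem abstract_iso {I L U C : Type*} [CommGroup I] [CommGroup L] [CommGroup U] [CommGroup C]
    [Finite C] (P : L →* I) (j : U →* L) (cl : I →* C) (n : ℕ)
    (hj : Function.Injective j) (hP : ∀ x, P x = 1 ↔ ∃ u, j u = x)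
    (hs : Function.Surjective cl) (hcl : ∀ a, cl a = 1 ↔ ∃ x, P x = a)
    (X Y : Subgroup (I × L)) (hX : ∀ p, p ∈ X ↔ p.1 ^ n = P p.2)
    (hY : ∀ p, p ∈ Y ↔ ∃ b, (P b, b ^ n) = p) :
    Nonempty ((X ⧸ Y.subgroupOf X) ≃* ((U ⧸ (powMonoidHom n : U →* U).range) ×
      (powMonoidHom n : C →* C).ker)) := by
  have hPj : ∀ u, P (j u) = 1 := fun u => (hP _).2 ⟨u, rfl⟩
  let i0 : U →* X :=
    { toFun := fun u => ⟨(1, j u), by rw [hX]; simp [hPj]⟩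
      map_one' := by ext <;> simp
      map_mul' := by intro a b; ext <;> simp }
  let i1 : U →* X ⧸ Y.subgroupOf X := (QuotientGroup.mk' _).comp i0
  have hi1 : ∀ u, i1 u = 1 ↔ u ∈ (powMonoidHom n : U →* U).range := by
    intro u
    have : i1 u = 1 ↔ i0 u ∈ Y.subgroupOf X := QuotientGroup.eq_one_iff _
    rw [this, Subgroup.mem_subgroupOf, hY]
    constructor
    · rintro ⟨b, hb⟩
      have h1 : P b = 1 := congrArg Prod.fst hb
      have h2 : b ^ n = j u := congrArg Prod.snd hb
      obtain ⟨v, rfl⟩ := (hP b).1 h1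
      exact ⟨v, hj (by simpa using h2)⟩
    · rintro ⟨v, rfl⟩
      exact ⟨j v, by simp [i0, hPj]⟩
  let i : U ⧸ (powMonoidHom n : U →* U).range →* X ⧸ Y.subgroupOf X :=
    QuotientGroup.lift _ i1 (fun u hu => (hi1 u).2 hu)
  let π0 : X →* (powMonoidHom n : C →* C).ker :=
    { toFun := fun p => ⟨cl p.1.1, by
        have := (hX _).1 p.2
        rw [MonoidHom.mem_ker, powMonoidHom_apply, ← map_pow, this]
        exact (hcl _).2 ⟨_, rfl⟩⟩
      map_one' := by ext; simp
      map_mul' := by intro a b; ext; simp }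
  let π : X ⧸ Y.subgroupOf X →* (powMonoidHom n : C →* C).ker :=
    QuotientGroup.lift _ π0 (by
      rintro ⟨p, hp⟩ hpY
      rw [Subgroup.mem_subgroupOf, hY] at hpY
      obtain ⟨b, rfl⟩ := hpY
      ext
      exact (hcl _).2 ⟨b, rfl⟩)
  have hπ : ∀ p : X, (π (QuotientGroup.mk p) : C) = cl p.1.1 := fun p => rfl
  obtain ⟨s, hsec⟩ := exists_section π (by
    rintro ⟨c, hc⟩
    obtain ⟨a, rfl⟩ := hs c
    have hc' : (cl a) ^ n = 1 := hc
    obtain ⟨k, hk⟩ := orderOf_dvd_of_pow_eq_one hc'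
    have : cl (a ^ orderOf (cl a)) = 1 := by rw [map_pow, pow_orderOf_eq_one]
    obtain ⟨x, hx⟩ := (hcl _).1 this
    have hmem : (a, x ^ k) ∈ X := by
      rw [hX]; simp only [map_pow, hx]; rw [← pow_mul, ← hk]
    refine ⟨QuotientGroup.mk ⟨_, hmem⟩, ?_, ?_⟩
    · ext; rfl
    · rw [Subgroup.orderOf_mk, ← QuotientGroup.mk_pow, QuotientGroup.eq_one_iff,
        Subgroup.mem_subgroupOf, hY]
      refine ⟨x, ?_⟩
      ext
      · simp [hx]
      · simp only [SubmonoidClass.mk_pow, Prod.pow_mk]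
        rw [← pow_mul, mul_comm k, ← hk])
  have hπi : ∀ q, π (i q) = 1 := by
    intro q
    induction q using QuotientGroup.induction_on with
    | H u => ext; exact map_one cl
  have hker : ∀ q, π q = 1 → ∃ u, i u = q := by
    intro q hq
    induction q using QuotientGroup.induction_on with
    | H p =>
      obtain ⟨⟨a, x⟩, hp⟩ := p
      have h1 : cl a = 1 := congrArg Subtype.val hq
      obtain ⟨b, rfl⟩ := (hcl a).1 h1
      have h2 : P b ^ n = P x := (hX _).1 hp
      obtain ⟨u, hu⟩ := (hP (x * (b ^ n)⁻¹)).1 (by simp [h2])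
      refine ⟨QuotientGroup.mk u, ?_⟩
      change ((i0 u : X) : X ⧸ Y.subgroupOf X) = _
      rw [QuotientGroup.eq, Subgroup.mem_subgroupOf, hY]
      refine ⟨b, ?_⟩
      ext <;> simp [i0, hu]
  have hinj : ∀ q, i q = 1 → q = 1 := by
    intro q hq
    induction q using QuotientGroup.induction_on with
    | H u => exact (QuotientGroup.eq_one_iff _).2 ((hi1 u).1 hq)
  let F := MonoidHom.coprod i s
  refine ⟨(MulEquiv.ofBijective F ⟨?_, ?_⟩).symm⟩
  · rw [injective_iff_map_eq_one]
    rintro ⟨q, c⟩ h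
    have h' : i q * s c = 1 := h
    have hc : c = 1 := by
      have := congrArg π h'
      simpa [hπi, hsec] using this
    subst hc
    have := hinj q (by simpa using h')
    rw [this]; rfl
  · intro g
    obtain ⟨u, hu⟩ := hker (g * (s (π g))⁻¹) (by simp [hsec])
    exact ⟨(u, π g), by simp [F, hu]⟩

/-- For a real algebraic number field `K` with `[K:ℚ] ≥ 2` and `n ≥ 1`, the
quotient `X_n(K)/Y_n(K)` is isomorphic to `(𝒪_K^×/(𝒪_K^×)ⁿ) × Cl_n(K)`, where `Cl_n(K)` is
the `n`-torsion subgroup of the ideal class group of `K`. -/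
theorem Xn_quotient_Yn_isomorphism
    (hdeg : 2 ≤ Module.finrank ℚ ↥K) (hn : 0 < n) :
    Nonempty
      ((↥(Xn K n) ⧸ (Yn K n).subgroupOf (Xn K n)) ≃*
        (((𝓞 ↥K)ˣ ⧸ (powMonoidHom n : (𝓞 ↥K)ˣ →* (𝓞 ↥K)ˣ).range) ×
          ↥(powMonoidHom n : ClassGroup (𝓞 ↥K) →* ClassGroup (𝓞 ↥K)).ker)) := by
  refine abstract_iso (toPrincipalIdeal (𝓞 ↥K) ↥K)
    (Units.map (algebraMap (𝓞 ↥K) ↥K : 𝓞 ↥K →* ↥K))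
    ((ClassGroup.equiv (R := 𝓞 ↥K) ↥K).symm.toMonoidHom.comp (QuotientGroup.mk' _)) n
    ?_ ?_ ?_ ?_ (Xn K n) (Yn K n) (fun p => Iff.rfl) (fun p => Iff.rfl)
  · exact Units.map_injective (FaithfulSMul.algebraMap_injective (𝓞 ↥K) ↥K)
  · intro x
    rw [toPrincipalIdeal_eq_iff, Units.val_one, ← FractionalIdeal.spanSingleton_one, eq_comm,
      FractionalIdeal.spanSingleton_eq_spanSingleton]
    refine exists_congr fun u => ?_
    rw [Units.ext_iff, Units.smul_def, Algebra.smul_def, mul_one]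
    rfl
  · exact (ClassGroup.equiv (R := 𝓞 ↥K) ↥K).symm.surjective.comp (QuotientGroup.mk'_surjective _)
  · intro a
    rw [MonoidHom.comp_apply, MulEquiv.coe_toMonoidHom, MulEquiv.map_eq_one_iff]
    exact QuotientGroup.eq_one_iff _

end OESuperrigidity
end

section
/- Let n ≥ 1, let Λ be a countable group, and let F, G, c : ℝⁿ → Λ be measurable maps (with respect to Lebesgue measure on ℝⁿ and the discrete structure on Λ) such that F(u+v)·G(u) = c(v) for Lebesgue-a.e. (u,v) ∈ ℝⁿ × ℝⁿ. Then F is a.e. equal to a constant. -/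
open MeasureTheory
open scoped symmDiff

namespace OESuperrigidity

/-- A map into a (typically countable) discrete space is measurable iff all fibers are
measurable sets. -/
def MeasurableDiscrete {X Λ : Type*} [MeasurableSpace X] (f : X → Λ) : Prop :=
  ∀ l : Λ, MeasurableSet {x | f x = l}

/-- `a` defines an action of the group `G`. -/
def IsAction {G X : Type*} [Group G] (a : G → X → X) : Prop :=
  (∀ x, a 1 x = x) ∧ ∀ g h x, a (g * h) x = a g (a h x)

/-- Each map `a g` is measurable and the pushforward of `μ` under it is equivalent to `μ`. -/
def Nonsingular {ι X : Type*} [MeasurableSpace X] (μ : Measure X) (a : ι → X → X) : Prop :=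
  ∀ g, Measurable (a g) ∧ μ.map (a g) ≪ μ ∧ μ ≪ μ.map (a g)

/-- Every a.e. invariant measurable set is null or conull. -/
def ErgodicAction {ι X : Type*} [MeasurableSpace X] (μ : Measure X) (a : ι → X → X) : Prop :=
  ∀ S : Set X, MeasurableSet S → (∀ g, μ ((a g '' S) ∆ S) = 0) → μ S = 0 ∨ μ Sᶜ = 0

/-- The action is essentially free. -/
def EssentiallyFree {G X : Type*} [Group G] [MeasurableSpace X]
    (μ : Measure X) (a : G → X → X) : Prop :=
  ∀ g : G, g ≠ 1 → μ {x | a g x = x} = 0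

/-- The action is induced from a proper subgroup `G₀` acting on a positive-measure
`G₀`-invariant set `X₀` such that the translates of `X₀` over a set `R` of representatives of
the left cosets of `G₀` are pairwise disjoint up to null sets and cover `X` up to a null set. -/
def IsInduced {G X : Type*} [Group G] [MeasurableSpace X]
    (μ : Measure X) (a : G → X → X) : Prop :=
  ∃ G₀ : Subgroup G, G₀ ≠ ⊤ ∧ ∃ X₀ : Set X, MeasurableSet X₀ ∧ 0 < μ X₀ ∧
    (∀ g ∈ G₀, μ ((a g '' X₀) ∆ X₀) = 0) ∧
    ∃ R : Set G, (∀ g : G, ∃! r, r ∈ R ∧ g⁻¹ * r ∈ G₀) ∧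
      (R.Pairwise fun r s => μ (a r '' X₀ ∩ a s '' X₀) = 0) ∧
      μ (⋃ r ∈ R, a r '' X₀)ᶜ = 0

/-- The subgroup `H` admits a measurable fundamental domain for its action. -/
def HasFundamentalDomain {G X : Type*} [Group G] [MeasurableSpace X]
    (μ : Measure X) (a : G → X → X) (H : Subgroup G) : Prop :=
  ∃ U : Set X, MeasurableSet U ∧
    ((H : Set G).Pairwise fun g h => μ (a g '' U ∩ a h '' U) = 0) ∧
    μ (⋃ g ∈ H, a g '' U)ᶜ = 0

/-- A measurable `1`-cocycle for the action `a` with values in the group `Λ`. -/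
def IsCocycle {G X Λ : Type*} [Group G] [Group Λ] [MeasurableSpace X]
    (μ : Measure X) (a : G → X → X) (Ω : G → X → Λ) : Prop :=
  (∀ g, MeasurableDiscrete (Ω g)) ∧
    ∀ g h : G, ∀ᵐ x ∂μ, Ω (g * h) x = Ω g (a h x) * Ω h x

/-- The cocycle `Ω` is cohomologous to a group homomorphism. -/
def CohomologousToHom {G X Λ : Type*} [Group G] [Group Λ] [MeasurableSpace X]
    (μ : Measure X) (a : G → X → X) (Ω : G → X → Λ) : Prop :=
  ∃ δ : G →* Λ, ∃ φ : X → Λ, MeasurableDiscrete φ ∧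
    ∀ g : G, ∀ᵐ x ∂μ, Ω g x = (φ (a g x))⁻¹ * δ g * φ x

/-- The action is cocycle superrigid with countable targets. -/
def CocycleSuperrigid {G X : Type*} [Group G] [MeasurableSpace X]
    (μ : Measure X) (a : G → X → X) : Prop :=
  ∀ (Λ : Type) [Group Λ] [Countable Λ], ∀ Ω : G → X → Λ,
    IsCocycle μ a Ω → CohomologousToHom μ a Ω

/-- `ω` is (a strict version of) the logarithm of the Radon–Nikodym cocycle of the action. -/
def IsLogRNCocycle {G X : Type*} [Group G] [MeasurableSpace X]
    (μ : Measure X) (a : G → X → X) (ω : G → X → ℝ) : Prop :=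
  (∀ g, Measurable (ω g)) ∧
    (∀ g h : G, ∀ᵐ x ∂μ, ω (g * h) x = ω g (a h x) + ω h x) ∧
    ∀ g : G, (fun x => ENNReal.ofReal (Real.exp (ω g x))) =ᵐ[μ] (μ.map (a g⁻¹)).rnDeriv μ

/-- The `G`-invariant σ-finite measure `dμ(x) e^{-s} ds` on `X × ℝ` used for the
Maharam extension. -/
noncomputable def maharamMeasure {X : Type*} [MeasurableSpace X] (μ : Measure X) :
    Measure (X × ℝ) :=
  μ.prod (volume.withDensity fun s => ENNReal.ofReal (Real.exp (-s)))

/-- The Maharam extension `g · (x, s) = (g · x, ω(g, x) + s)`. -/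
def maharamAct {G X : Type*} (a : G → X → X) (ω : G → X → ℝ) : G → X × ℝ → X × ℝ :=
  fun g p => (a g p.1, ω g p.1 + p.2)

end OESuperrigidity

namespace OESuperrigidity

open MeasureTheory

/-- If `F, G, c : ℝⁿ → Λ` are measurable maps into a countable group `Λ`
such that `F(u+v) · G(u) = c(v)` for a.e. `(u,v)`, then `F` is a.e. constant. -/
theorem ae_constant_of_translation_relation
    {n : ℕ} (hn : 1 ≤ n) (Λ : Type) [Group Λ] [Countable Λ]
    (F G c : (Fin n → ℝ) → Λ)
    (hF : MeasurableDiscrete F) (hG : MeasurableDiscrete G) (hc : MeasurableDiscrete c)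
    (h : ∀ᵐ p : (Fin n → ℝ) × (Fin n → ℝ) ∂(volume : Measure ((Fin n → ℝ) × (Fin n → ℝ))),
      F (p.1 + p.2) * G p.1 = c p.2) :
    ∃ l : Λ, ∀ᵐ u ∂(volume : Measure (Fin n → ℝ)), F u = l := by
  let : MeasurableSpace Λ := ⊤
  have hFm : Measurable F := measurable_to_countable' fun l => hF l
  have h1 : ∀ᵐ v : Fin n → ℝ, ∀ᵐ u : Fin n → ℝ, F (u + v) * G u = c v := by
    have h2 := (Measure.measurePreserving_swap (μ := (volume : Measure (Fin n → ℝ)))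
      (ν := (volume : Measure (Fin n → ℝ)))).quasiMeasurePreserving.ae h
    exact Measure.ae_ae_of_ae_prod h2
  -- pick a fibre of `c` of positive measure
  have h3 : ∃ l : Λ, 0 < volume {v | c v = l} := by
    apply exists_measure_pos_of_not_measure_iUnion_null
    have : (⋃ l : Λ, {v | c v = l}) = Set.univ := by
      ext v; simp
    rw [this]
    exact isOpen_univ.measure_ne_zero volume Set.univ_nonempty
  obtain ⟨l, hl⟩ := h3
  set V : Set (Fin n → ℝ) := {v | ∀ᵐ u : Fin n → ℝ, F (u + v) * G u = c v} with hV
  obtain ⟨N, hNsub, hNm, hN0⟩ := exists_measurable_superset_of_null (show volume Vᶜ = 0 from h1)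
  set A : Set (Fin n → ℝ) := {v | c v = l} \ N with hA
  have hAm : MeasurableSet A := (hc l).diff hNm
  have hApos : 0 < volume A := by
    rw [hA, measure_sdiff_null hN0]; exact hl
  have hnhd := Measure.sub_mem_nhds_zero_of_addHaar_pos volume A hAm hApos
  open scoped Pointwise in
  have hloc : ∀ s ∈ A - A, ∀ᵐ x : Fin n → ℝ, F (x + s) = F x := by
    rintro s ⟨v, hv, w, hw, rfl⟩
    have hvV : v ∈ V := by
      by_contra hh; exact hv.2 (hNsub hh)
    have hwV : w ∈ V := by
      by_contra hh; exact hw.2 (hNsub hh)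
    have hvw : ∀ᵐ u : Fin n → ℝ, F (u + v) = F (u + w) := by
      filter_upwards [hvV, hwV] with u h4 h5
      have e1 : c v = l := hv.1
      have e2 : c w = l := hw.1
      rw [e1] at h4
      rw [e2] at h5
      exact mul_right_cancel (h4.trans h5.symm)
    have := (measurePreserving_add_right (volume : Measure (Fin n → ℝ)) (-w)).quasiMeasurePreserving.ae hvw
    filter_upwards [this] with x hx
    have e1 : x + -w + v = x + (v - w) := by abel
    have e2 : x + -w + w = x := by abel
    rw [e1, e2] at hx
    exact hx
  have hmul : ∀ s : Fin n → ℝ, (∀ᵐ x : Fin n → ℝ, F (x + s) = F x) → ∀ k : ℕ,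
      ∀ᵐ x : Fin n → ℝ, F (x + (k : ℝ) • s) = F x := by
    intro s hs k
    induction k with
    | zero => simp
    | succ k ih =>
      have := (measurePreserving_add_right (volume : Measure (Fin n → ℝ)) s).quasiMeasurePreserving.ae ih
      filter_upwards [this, hs] with x h4 h5
      have e : x + ((k + 1 : ℕ) : ℝ) • s = x + s + (k : ℝ) • s := by
        push_cast; rw [add_smul, one_smul]; abel
      rw [e, h4, h5]
  have hall : ∀ t : Fin n → ℝ, ∀ᵐ x : Fin n → ℝ, F (x + t) = F x := by
    intro t
    have ht : Filter.Tendsto (fun k : ℕ => ((k : ℝ))⁻¹ • t) Filter.atTop (nhds 0) := by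
      have := (tendsto_inv_atTop_nhds_zero_nat (𝕜 := ℝ)).smul_const t
      simpa using this
    obtain ⟨k, hk, hk0⟩ := ((ht.eventually hnhd).and (Filter.eventually_gt_atTop 0)).exists
    have := hmul _ (hloc _ hk) k
    rwa [smul_inv_smul₀ (by positivity)] at this
  have hms : MeasurableSet {p : (Fin n → ℝ) × (Fin n → ℝ) | F (p.2 + p.1) = F p.2} :=
    measurableSet_eq_fun (hFm.comp (measurable_snd.add measurable_fst)) (hFm.comp measurable_snd)
  have h6 : ∀ᵐ x : Fin n → ℝ, ∀ᵐ t : Fin n → ℝ, F (x + t) = F x :=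
    (Measure.ae_ae_comm hms).1 (Filter.Eventually.of_forall hall)
  obtain ⟨x, hx⟩ := h6.exists
  refine ⟨F x, ?_⟩
  have := (measurePreserving_add_right (volume : Measure (Fin n → ℝ)) (-x)).quasiMeasurePreserving.ae hx
  filter_upwards [this] with y hy
  have e : x + (y + -x) = y := by abel
  rwa [e] at hy

end OESuperrigidity
end

section
/- Let n ≥ 2 and let V ⊆ ℝⁿ be a closed additive subgroup with V ≠ {0} such that A·V = V for every A ∈ SL(n,ℝ). Then V = ℝⁿ. Equivalently, every nonzero additive subgroup of ℝⁿ that is globally invariant under SL(n,ℝ) is dense in ℝⁿ. -/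
theorem sl_aux_top (n : ℕ) (hn : 2 ≤ n) (W : AddSubgroup (Fin n → ℝ)) (hW : W ≠ ⊥)
    (hA : ∀ A : Matrix.SpecialLinearGroup (Fin n) ℝ,
        (fun v => (A : Matrix (Fin n) (Fin n) ℝ).mulVec v) '' (W : Set (Fin n → ℝ))
          = (W : Set (Fin n → ℝ))) : W = ⊤ := by
  have key : ∀ v ∈ W, ∀ i j : Fin n, i ≠ j → v j ≠ 0 → ∀ s : ℝ, Pi.single i s ∈ W := by
    intro v hv i j hij hj s
    have h1 : (Matrix.transvection i j (s / v j)).mulVec v ∈ W := by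
      have h2 := hA ⟨Matrix.transvection i j (s / v j), Matrix.det_transvection_of_ne i j hij _⟩
      have h3 : (Matrix.transvection i j (s / v j)).mulVec v ∈ (W : Set (Fin n → ℝ)) := by
        rw [← h2]
        exact ⟨v, hv, rfl⟩
      exact h3
    have h4 : (Matrix.transvection i j (s / v j)).mulVec v = v + Pi.single i s := by
      rw [Matrix.transvection, Matrix.add_mulVec, Matrix.one_mulVec, Matrix.single_mulVec]
      congr 1
      rw [div_mul_cancel₀ _ hj]
      rfl
    rw [h4] at h1
    simpa using W.sub_mem h1 hv
  obtain ⟨v, hv, hv0⟩ := AddSubgroup.ne_bot_iff_exists_ne_zero.1 hW |>.elim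
    fun a ha => (⟨a.1, a.2, fun h => ha (Subtype.ext h)⟩ : ∃ v, v ∈ W ∧ v ≠ 0)
  obtain ⟨j, hj⟩ := Function.ne_iff.1 hv0
  have : Nontrivial (Fin n) := Fin.nontrivial_iff_two_le.2 hn
  obtain ⟨k, hk⟩ := exists_ne j
  have all : ∀ i : Fin n, ∀ s : ℝ, Pi.single i s ∈ W := by
    intro i s
    by_cases hij : i = j
    · subst hij
      exact key _ (key v hv k i hk hj 1) i k hk.symm (by simp) s
    · exact key v hv i j hij hj s
  rw [eq_top_iff]
  intro x _
  rw [← Finset.univ_sum_single x]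
  exact W.sum_mem fun i _ => all i _

/-- For `n ≥ 2`, every nonzero closed additive subgroup of `ℝⁿ` that is
globally invariant under `SL(n,ℝ)` equals `ℝⁿ`; equivalently, every nonzero additive subgroup
of `ℝⁿ` that is globally invariant under `SL(n,ℝ)` is dense in `ℝⁿ`. -/
theorem sl_invariant_subgroup_closed_eq_top_and_dense
    (n : ℕ) (hn : 2 ≤ n) :
    (∀ V : AddSubgroup (Fin n → ℝ), IsClosed (V : Set (Fin n → ℝ)) → V ≠ ⊥ →
      (∀ A : Matrix.SpecialLinearGroup (Fin n) ℝ,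
        (fun v => (A : Matrix (Fin n) (Fin n) ℝ).mulVec v) '' (V : Set (Fin n → ℝ))
          = (V : Set (Fin n → ℝ))) →
      V = ⊤) ∧
    (∀ W : AddSubgroup (Fin n → ℝ), W ≠ ⊥ →
      (∀ A : Matrix.SpecialLinearGroup (Fin n) ℝ,
        (fun v => (A : Matrix (Fin n) (Fin n) ℝ).mulVec v) '' (W : Set (Fin n → ℝ))
          = (W : Set (Fin n → ℝ))) →
      Dense (W : Set (Fin n → ℝ))) := by
  refine ⟨fun V _ h0 hA => sl_aux_top n hn V h0 hA, fun W h0 hA => ?_⟩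
  rw [sl_aux_top n hn W h0 hA]
  simp
end
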